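/- arXiv:1106.1913 — 3 statements merged into one kernel-verified Lean document; each statement's English description precedes it below -/
import Mathlib

section
/- Let M be a finitely generated module over S = k[x_1,...,x_n]. Let F be the chain complex of S-modules with F_p = S ⊗_k Λ^p(k^n) ⊗_k M for p ≥ 0 (S acting on the left tensor factor), whose S-linear differential is determined on elements 1 ⊗ e_I ⊗ m (I ⊆ {1,...,n}, m ∈ M) by d(1 ⊗ e_I ⊗ m) = Σ_{i ∈ I} (−1)^{#{j ∈ I : j < i}} ( x_i ⊗ e_{I∖{i}} ⊗ m − 1 ⊗ e_{I∖{i}} ⊗ x_i·m ). Then F is a free resolution of M: each F_p is a free S-module, d ∘ d = 0, H_p(F) = 0 for all p ≥ 1, and the S-linear augmentation ε: F_0 = S ⊗_k M → M, s ⊗ m ↦ s·m, is surjective with kernel equal to the image of d_1, so that it induces an isomorphism H_0(F) ≅ M. -/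
open MvPolynomial TensorProduct

set_option maxHeartbeats 1000000
set_option synthInstance.maxHeartbeats 400000

/-- The `p`-th exterior power `Λ^p(k^n)` (a type wrapper around `⋀[k]^p (Fin n → k)`). -/
def ExtPower (k : Type) [Field k] (n p : ℕ) : Type := ⋀[k]^p (Fin n → k)

noncomputable instance (k : Type) [Field k] (n p : ℕ) : AddCommGroup (ExtPower k n p) :=
  inferInstanceAs (AddCommGroup (⋀[k]^p (Fin n → k)))

noncomputable instance (k : Type) [Field k] (n p : ℕ) : Module k (ExtPower k n p) :=
  inferInstanceAs (Module k (⋀[k]^p (Fin n → k)))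

/-- The wedge-basis element `e_I ∈ Λ^p(k^n)` associated to a subset `I ⊆ {1,…,n}` of
cardinality `p`: the wedge `e_{i_1} ∧ … ∧ e_{i_p}` of the standard basis vectors of `k^n`
indexed by the elements of `I` in increasing order. -/
noncomputable def eSet (k : Type) [Field k] {n : ℕ} (p : ℕ) (I : Finset (Fin n))
    (h : I.card = p) : ExtPower k n p :=
  (⟨ExteriorAlgebra.ιMulti k p (fun j => Pi.single (↑(I.orderIsoOfFin h j)) 1),
    ExteriorAlgebra.ιMulti_range k p (Set.mem_range_self _)⟩ : ⋀[k]^p (Fin n → k))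

/-- The modules of the two-sided Koszul complex: `F_p = S ⊗_k Λ^p(k^n) ⊗_k M`, an
`S`-module via the left tensor factor. -/
noncomputable abbrev Fmod (k : Type) [Field k] (n : ℕ) (M : Type) [AddCommGroup M]
    [Module k M] (p : ℕ) : Type :=
  (MvPolynomial (Fin n) k) ⊗[k] ((ExtPower k n p) ⊗[k] M)

open Finset

section Homotopy

variable {n : ℕ} {N : Type*} [AddCommGroup N] {F : ℕ → Type*} [∀ p, AddCommGroup (F p)]

theorem Fin.sum_Iio_sub_succ (a : Fin n) (f : ℕ → N) :
    ∑ i ∈ Finset.Iio a, (f i - f (i + 1)) = f 0 - f a := by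
  rw [← Finset.sum_range_sub', ← Nat.Iio_eq_range, ← Fin.map_valEmbedding_Iio, Finset.sum_map]
  rfl

theorem Fin.sum_univ_sub_succ (f : ℕ → N) :
    ∑ i : Fin n, (f i - f (i + 1)) = f 0 - f n := by
  rw [← Finset.sum_range_sub', Finset.sum_range]

/-- The Koszul sign of removing `i` from `I`. -/
def koszulSign (I : Finset (Fin n)) (i : Fin n) : ℤ := (-1) ^ #{j ∈ I | j < i}

theorem koszulSign_eq_one {I : Finset (Fin n)} {i : Fin n} (h : ∀ j ∈ I, i ≤ j) :
    koszulSign I i = 1 := by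
  rw [koszulSign, Finset.filter_false_of_mem fun j hj => not_lt.2 (h j hj)]
  simp

theorem koszulSign_insert_of_lt {I : Finset (Fin n)} {i l : Fin n} (hi : i ∉ I) (h : i < l) :
    koszulSign (insert i I) l = -koszulSign I l := by
  rw [koszulSign, koszulSign, Finset.filter_insert, if_pos h,
    Finset.card_insert_of_notMem (by simp [hi]), pow_succ]
  ring

theorem koszulSign_erase_of_lt {I : Finset (Fin n)} {i l : Fin n} (hi : i ∈ I) (h : i < l) :
    koszulSign (I.erase i) l = -koszulSign I l := by
  conv_rhs => rw [← Finset.insert_erase hi, koszulSign_insert_of_lt (by simp) h]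
  simp

theorem koszulSign_erase_of_le {I : Finset (Fin n)} {i l : Fin n} (h : l ≤ i) :
    koszulSign (I.erase i) l = koszulSign I l := by
  rw [koszulSign, koszulSign, Finset.filter_erase, Finset.erase_eq_of_notMem]
  simp [h]

theorem koszulSign_mul_erase {I : Finset (Fin n)} {i l : Fin n} (hi : i ∈ I) (hl : l ∈ I)
    (h : i ≠ l) :
    koszulSign I i * koszulSign (I.erase i) l = -(koszulSign I l * koszulSign (I.erase l) i) := by
  rcases lt_or_gt_of_ne h with h | h
  · rw [koszulSign_erase_of_lt hi h, koszulSign_erase_of_le h.le]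
    ring
  · rw [koszulSign_erase_of_lt hl h, koszulSign_erase_of_le h.le]
    ring

variable (j : ∀ p, Finset (Fin n) → N →+ F p) (D H : Fin n → N →+ N) (P : ℕ → N →+ N)
  (d : ∀ p, F (p + 1) →+ F p) (s : ∀ p, F p →+ F (p + 1))

theorem koszul_d_comp_d
    (hd : ∀ p I x, #I = p + 1 →
      d p (j (p + 1) I x) = ∑ i ∈ I, koszulSign I i • j p (I.erase i) (D i x))
    (hDD : ∀ i l x, D i (D l x) = D l (D i x))
    (p : ℕ) (I : Finset (Fin n)) (hI : #I = p + 2) (x : N) :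
    d p (d (p + 1) (j (p + 2) I x)) = 0 := by
  have key : d p (d (p + 1) (j (p + 2) I x)) = ∑ q ∈ I.sigma fun i => I.erase i,
      (koszulSign I q.1 * koszulSign (I.erase q.1) q.2) •
        j p ((I.erase q.1).erase q.2) (D q.2 (D q.1 x)) := by
    rw [hd (p + 1) I x hI, map_sum, Finset.sum_sigma]
    refine Finset.sum_congr rfl fun i hi => ?_
    rw [map_zsmul, hd p _ _ (by rw [Finset.card_erase_of_mem hi, hI]; rfl), Finset.smul_sum]
    simp only [smul_smul]
  rw [key]
  refine Finset.sum_involution (fun q _ => ⟨q.2, q.1⟩) ?_ ?_ ?_ ?_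
  · rintro ⟨i, l⟩ h
    simp only [Finset.mem_sigma, Finset.mem_erase] at h
    simp only
    rw [koszulSign_mul_erase h.1 h.2.2 h.2.1.symm, hDD l i, Finset.erase_right_comm, neg_smul,
      neg_add_cancel]
  · rintro ⟨i, l⟩ h - heq
    simp only [Finset.mem_sigma, Finset.mem_erase] at h
    simp only [Sigma.mk.injEq, heq_eq_eq] at heq
    exact h.2.1 heq.1
  · rintro ⟨i, l⟩ h
    simp only [Finset.mem_sigma, Finset.mem_erase] at h ⊢
    exact ⟨h.2.2, h.2.1.symm, h.1⟩
  · rintro ⟨i, l⟩ h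
    rfl

theorem koszul_homotopy_zero
    (hd : ∀ p I x, #I = p + 1 →
      d p (j (p + 1) I x) = ∑ i ∈ I, koszulSign I i • j p (I.erase i) (D i x))
    (hs : ∀ p I x, #I = p →
      s p (j p I x) = ∑ i with ∀ a ∈ I, i < a, j (p + 1) (insert i I) (H i x))
    (hP : ∀ x, P 0 x = x)
    (hDH : ∀ (i : Fin n) x, D i (H i x) = P i x - P (i + 1) x) (x : N) :
    d 0 (s 0 (j 0 ∅ x)) = j 0 ∅ (x - P n x) := by
  rw [hs 0 ∅ x rfl, map_sum]
  simp only [Finset.notMem_empty, IsEmpty.forall_iff, implies_true, Finset.filter_true,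
    insert_empty_eq]
  have (i : Fin n) : d 0 (j (0 + 1) {i} (H i x)) = j 0 ∅ (P i x - P (i + 1) x) := by
    rw [hd _ _ _ (by simp), Finset.sum_singleton, koszulSign_eq_one (by simp), one_smul, hDH]
    simp
  rw [Finset.sum_congr rfl fun i _ => this i, ← map_sum, Fin.sum_univ_sub_succ (fun i => P i x), hP]

theorem koszul_homotopy
    (hd : ∀ p I x, #I = p + 1 →
      d p (j (p + 1) I x) = ∑ i ∈ I, koszulSign I i • j p (I.erase i) (D i x))
    (hs : ∀ p I x, #I = p →
      s p (j p I x) = ∑ i with ∀ a ∈ I, i < a, j (p + 1) (insert i I) (H i x))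
    (hP : ∀ x, P 0 x = x)
    (hDH : ∀ (i : Fin n) x, D i (H i x) = P i x - P (i + 1) x)
    (hHD : ∀ (i : Fin n) x, H i (D i x) = P i x)
    (hHD_lt : ∀ i l x, i < l → H i (D l x) = D l (H i x))
    (hHD_gt : ∀ i l x, l < i → H i (D l x) = 0)
    (p : ℕ) (I : Finset (Fin n)) (hI : #I = p + 1) (x : N) :
    d (p + 1) (s (p + 1) (j (p + 1) I x)) + s p (d p (j (p + 1) I x)) = j (p + 1) I x := by
  have hne : I.Nonempty := Finset.card_pos.1 (by omega)
  obtain ⟨a, ha, hmin⟩ : ∃ a ∈ I, ∀ b ∈ I, a ≤ b :=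
    ⟨I.min' hne, I.min'_mem hne, fun b hb => I.min'_le b hb⟩
  have hfilter {K : Finset (Fin n)} (haK : a ∈ K) (hK : K ⊆ I) :
      ({i | ∀ b ∈ K, i < b} : Finset (Fin n)) = Finset.Iio a := by
    ext i
    simp only [Finset.mem_filter, Finset.mem_univ, true_and, Finset.mem_Iio]
    exact ⟨fun h => h a haK, fun h b hb => h.trans_le (hmin b (hK hb))⟩
  have hterm (i : Fin n) (hi : i ∈ Finset.Iio a) :
      d (p + 1) (j (p + 2) (insert i I) (H i x)) = j (p + 1) I (P i x - P (i + 1) x) -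
        ∑ l ∈ I, koszulSign I l • j (p + 1) (insert i (I.erase l)) (D l (H i x)) := by
    have hlt (l) (hl : l ∈ I) : i < l := (Finset.mem_Iio.1 hi).trans_le (hmin l hl)
    have hiI : i ∉ I := fun h => (hlt i h).false
    rw [hd _ _ _ (by rw [Finset.card_insert_of_notMem hiI, hI]), Finset.sum_insert hiI,
      koszulSign_eq_one (by simpa using fun l hl => (hlt l hl).le), one_smul,
      Finset.erase_insert hiI, hDH, sub_eq_add_neg _ (∑ l ∈ I, _), ← Finset.sum_neg_distrib]
    congr 1
    refine Finset.sum_congr rfl fun l hl => ?_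
    rw [koszulSign_insert_of_lt hiI (hlt l hl), neg_smul,
      Finset.erase_insert_of_ne (hlt l hl).ne]
  have hds : d (p + 1) (s (p + 1) (j (p + 1) I x)) = j (p + 1) I (x - P a x) -
      ∑ i ∈ Finset.Iio a, ∑ l ∈ I,
        koszulSign I l • j (p + 1) (insert i (I.erase l)) (D l (H i x)) := by
    rw [hs _ _ _ hI, hfilter ha subset_rfl, map_sum, Finset.sum_congr rfl hterm,
      Finset.sum_sub_distrib, ← map_sum, Fin.sum_Iio_sub_succ a (fun i => P i x), hP]
  have hcard (l) (hl : l ∈ I) : #(I.erase l) = p := by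
    rw [Finset.card_erase_of_mem hl, hI, Nat.add_sub_cancel]
  have hother (l) (hl : l ∈ I.erase a) :
      s p (koszulSign I l • j p (I.erase l) (D l x)) =
        ∑ i ∈ Finset.Iio a,
          koszulSign I l • j (p + 1) (insert i (I.erase l)) (D l (H i x)) := by
    obtain ⟨hla, hl⟩ := Finset.mem_erase.1 hl
    rw [map_zsmul, hs _ _ _ (hcard l hl),
      hfilter (Finset.mem_erase.2 ⟨hla.symm, ha⟩) (Finset.erase_subset _ _), Finset.smul_sum]
    refine Finset.sum_congr rfl fun i hi => ?_
    rw [hHD_lt i l x ((Finset.mem_Iio.1 hi).trans_le (hmin l hl))]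
  have hfirst : s p (koszulSign I a • j p (I.erase a) (D a x)) =
      (∑ i ∈ Finset.Iio a,
        koszulSign I a • j (p + 1) (insert i (I.erase a)) (D a (H i x))) +
        j (p + 1) I (P a x) := by
    rw [koszulSign_eq_one hmin, one_smul, hs _ _ _ (hcard a ha),
      ← Finset.sum_subset (s₁ := insert a (Finset.Iio a)), Finset.sum_insert (by simp), hHD,
      Finset.insert_erase ha, add_comm (j (p + 1) I (P a x))]
    · congr 1
      refine Finset.sum_congr rfl fun i hi => ?_
      rw [hHD_lt i a x (Finset.mem_Iio.1 hi), one_smul]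
    · intro i hi
      simp only [Finset.mem_filter, Finset.mem_univ, true_and]
      intro b hb
      obtain ⟨hba, hb⟩ := Finset.mem_erase.1 hb
      have hab := lt_of_le_of_ne (hmin b hb) hba.symm
      rcases Finset.mem_insert.1 hi with rfl | hi
      · exact hab
      · exact (Finset.mem_Iio.1 hi).trans hab
    · intro i _ hi
      rw [hHD_gt i a x, map_zero]
      simp only [Finset.mem_insert, Finset.mem_Iio, not_or, not_lt] at hi
      exact lt_of_le_of_ne hi.2 (Ne.symm hi.1)
  have hsd : s p (d p (j (p + 1) I x)) = j (p + 1) I (P a x) +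
      ∑ i ∈ Finset.Iio a, ∑ l ∈ I,
        koszulSign I l • j (p + 1) (insert i (I.erase l)) (D l (H i x)) := by
    rw [hd _ _ _ hI, map_sum, ← Finset.add_sum_erase _ _ ha, hfirst,
      Finset.sum_congr rfl hother, Finset.sum_comm (s := Finset.Iio a),
      ← Finset.add_sum_erase I _ ha]
    abel
  rw [hds, hsd, map_sub]
  abel

end Homotopy

section DividedDifference

variable (k : Type*) [Field k] {n : ℕ}

local notation "S" => MvPolynomial (Fin n) k

instance : IsDomain (S ⊗[k] S) :=
  (MvPolynomial.algebraTensorAlgEquiv k S (σ := Fin n)).toMulEquiv.isDomain _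

/-- The element `x_i ⊗ 1 - 1 ⊗ x_i` of `S ⊗ S`. -/
noncomputable def diagGen (i : Fin n) : S ⊗[k] S := X i ⊗ₜ 1 - 1 ⊗ₜ X i

theorem diagGen_ne_zero (i : Fin n) : diagGen k i ≠ 0 := by
  intro h
  have h' := congrArg (MvPolynomial.algebraTensorAlgEquiv k S (σ := Fin n)) h
  simp only [diagGen, map_sub, MvPolynomial.algebraTensorAlgEquiv_tmul, map_zero, map_one,
    MvPolynomial.map_X, one_smul] at h'
  have h'' := congrArg (MvPolynomial.coeff (Finsupp.single i 1)) h'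
  have hi : (0 : Fin n →₀ ℕ) ≠ Finsupp.single i 1 := (Finsupp.single_ne_zero.2 one_ne_zero).symm
  simp [MvPolynomial.coeff_smul, MvPolynomial.coeff_one, hi] at h''

/-- The algebra map `S → S ⊗ S` sending `x_l` to `1 ⊗ x_l` for `l < i`, and to `x_l ⊗ 1`
otherwise. -/
noncomputable def mixHom (i : ℕ) : S →ₐ[k] S ⊗[k] S :=
  aeval fun l : Fin n => if (l : ℕ) < i then 1 ⊗ₜ X l else X l ⊗ₜ 1

variable {k}

theorem mixHom_X_of_lt {i : ℕ} {l : Fin n} (h : (l : ℕ) < i) :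
    mixHom k i (X l) = 1 ⊗ₜ X l := by
  simp [mixHom, h]

theorem mixHom_X_of_le {i : ℕ} {l : Fin n} (h : i ≤ (l : ℕ)) :
    mixHom k i (X l) = X l ⊗ₜ 1 := by
  simp [mixHom, h]

theorem mixHom_zero (f : S) : mixHom k 0 f = f ⊗ₜ 1 := by
  have : mixHom k 0 = (Algebra.TensorProduct.includeLeft : S →ₐ[k] S ⊗[k] S) :=
    MvPolynomial.algHom_ext fun l => mixHom_X_of_le (Nat.zero_le _)
  rw [this]
  rfl

theorem mixHom_self (f : S) : mixHom k n f = 1 ⊗ₜ f := by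
  have : mixHom k n = (Algebra.TensorProduct.includeRight : S →ₐ[k] S ⊗[k] S) :=
    MvPolynomial.algHom_ext fun l => mixHom_X_of_lt l.2
  rw [this]
  rfl

theorem diagGen_dvd_mixHom_sub (i : Fin n) (f : S) :
    diagGen k i ∣ mixHom k i f - mixHom k (i + 1) f := by
  induction f using MvPolynomial.induction_on with
  | C a => simp [MvPolynomial.algHom_C]
  | add p q hp hq =>
    rw [map_add, map_add, add_sub_add_comm]
    exact dvd_add hp hq
  | mul_X p l hp =>
    have hX : diagGen k i ∣ mixHom k i (X l) - mixHom k (i + 1) (X l) := by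
      rcases lt_trichotomy l i with h | rfl | h
      · rw [mixHom_X_of_lt h, mixHom_X_of_lt (Nat.lt_succ_of_lt h), sub_self]
        exact dvd_zero _
      · rw [mixHom_X_of_le le_rfl, mixHom_X_of_lt (Nat.lt_succ_self _)]
        exact dvd_rfl
      · rw [mixHom_X_of_le h.le, mixHom_X_of_le h, sub_self]
        exact dvd_zero _
    rw [map_mul, map_mul, show ∀ a b c e : S ⊗[k] S, a * b - c * e = (a - c) * b + c * (b - e) by
      intros; ring]
    exact dvd_add (hp.mul_right _) (hX.mul_left _)

variable (k) in
/-- The divided difference `(mixHom i f - mixHom (i + 1) f) / (x_i ⊗ 1 - 1 ⊗ x_i)`. -/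
noncomputable def divDiff (i : Fin n) : S →ₗ[k] S ⊗[k] S where
  toFun f := (diagGen_dvd_mixHom_sub i f).choose
  map_add' f g := by
    apply mul_left_cancel₀ (diagGen_ne_zero k i)
    rw [mul_add, ← (diagGen_dvd_mixHom_sub i f).choose_spec,
      ← (diagGen_dvd_mixHom_sub i g).choose_spec,
      ← (diagGen_dvd_mixHom_sub i (f + g)).choose_spec, map_add, map_add]
    abel
  map_smul' c f := by
    apply mul_left_cancel₀ (diagGen_ne_zero k i)
    rw [RingHom.id_apply, mul_smul_comm, ← (diagGen_dvd_mixHom_sub i f).choose_spec,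
      ← (diagGen_dvd_mixHom_sub i (c • f)).choose_spec, map_smul, map_smul, smul_sub]

theorem diagGen_mul_divDiff (i : Fin n) (f : S) :
    diagGen k i * divDiff k i f = mixHom k i f - mixHom k (i + 1) f :=
  (diagGen_dvd_mixHom_sub i f).choose_spec.symm

theorem divDiff_X_mul_of_gt {i l : Fin n} (h : l < i) (f : S) :
    divDiff k i (X l * f) = 1 ⊗ₜ X l * divDiff k i f := by
  apply mul_left_cancel₀ (diagGen_ne_zero k i)
  rw [mul_left_comm, diagGen_mul_divDiff, diagGen_mul_divDiff, map_mul, map_mul,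
    mixHom_X_of_lt h, mixHom_X_of_lt (Nat.lt_succ_of_lt h), mul_sub]

theorem divDiff_X_mul_of_lt {i l : Fin n} (h : i < l) (f : S) :
    divDiff k i (X l * f) = X l ⊗ₜ 1 * divDiff k i f := by
  apply mul_left_cancel₀ (diagGen_ne_zero k i)
  rw [mul_left_comm, diagGen_mul_divDiff, diagGen_mul_divDiff, map_mul, map_mul,
    mixHom_X_of_le h.le, mixHom_X_of_le h, mul_sub]

theorem divDiff_X_mul_self (i : Fin n) (f : S) :
    divDiff k i (X i * f) = mixHom k i f + 1 ⊗ₜ X i * divDiff k i f := by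
  apply mul_left_cancel₀ (diagGen_ne_zero k i)
  rw [mul_add, mul_left_comm, diagGen_mul_divDiff, diagGen_mul_divDiff, map_mul, map_mul,
    mixHom_X_of_le le_rfl, mixHom_X_of_lt (Nat.lt_succ_self _), diagGen]
  ring

end DividedDifference

section Bimodule

variable (k : Type*) [Field k] {n : ℕ} (M : Type*) [AddCommGroup M] [Module k M]
  [Module (MvPolynomial (Fin n) k) M] [IsScalarTower k (MvPolynomial (Fin n) k) M]

local notation "S" => MvPolynomial (Fin n) k

/-- The action of `S ⊗ S` on `S ⊗ M` through both tensor factors. -/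
noncomputable def biAct : S ⊗[k] S →ₐ[k] Module.End k (S ⊗[k] M) :=
  (Module.endTensorEndAlgHom :
    Module.End k S ⊗[k] Module.End k M →ₐ[k] Module.End k (S ⊗[k] M)).comp
    (Algebra.TensorProduct.map (Algebra.lmul k S) (Algebra.lsmul k k M))

/-- The endomorphism `f ⊗ m ↦ φ f • (1 ⊗ m)` of `S ⊗ M` induced by `φ : S → S ⊗ S`. -/
noncomputable def biOp (φ : S →ₗ[k] S ⊗[k] S) : S ⊗[k] M →ₗ[k] S ⊗[k] M :=
  TensorProduct.lift
    (LinearMap.lcomp k (S ⊗[k] M) (TensorProduct.mk k S M 1) ∘ₗ (biAct k M).toLinearMap ∘ₗ φ)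

variable {k M}

@[simp]
theorem biAct_tmul_tmul (a b f : S) (m : M) :
    biAct k M (a ⊗ₜ b) (f ⊗ₜ m) = (a * f) ⊗ₜ (b • m) := rfl

@[simp]
theorem biOp_tmul (φ : S →ₗ[k] S ⊗[k] S) (f : S) (m : M) :
    biOp k M φ (f ⊗ₜ m) = biAct k M (φ f) (1 ⊗ₜ m) := rfl

theorem biAct_biAct (a b : S ⊗[k] S) (x : S ⊗[k] M) :
    biAct k M a (biAct k M b x) = biAct k M (a * b) x := by
  rw [map_mul, Module.End.mul_apply]

theorem biAct_diagGen_tmul (i : Fin n) (f : S) (m : M) :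
    biAct k M (diagGen k i) (f ⊗ₜ m) = (X i * f) ⊗ₜ m - f ⊗ₜ ((X i : S) • m) := by
  simp [diagGen, map_sub, LinearMap.sub_apply]

theorem biOp_biAct_diagGen_tmul (φ : S →ₗ[k] S ⊗[k] S) (i : Fin n) (f : S) (m : M) :
    biOp k M φ (biAct k M (diagGen k i) (f ⊗ₜ m)) =
      biAct k M (φ (X i * f) - 1 ⊗ₜ X i * φ f) (1 ⊗ₜ m) := by
  have : (1 : S) ⊗ₜ[k] ((X i : S) • m) = biAct k M (1 ⊗ₜ X i) (1 ⊗ₜ m) := by simp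
  rw [biAct_diagGen_tmul, map_sub, biOp_tmul, biOp_tmul, this, biAct_biAct, map_sub,
    LinearMap.sub_apply, mul_comm (φ f)]

theorem biOp_mixHom_zero (x : S ⊗[k] M) : biOp k M (mixHom k 0).toLinearMap x = x := by
  induction x with
  | zero => simp
  | add x y hx hy => rw [map_add, hx, hy]
  | tmul f m => simp [mixHom_zero]

theorem biOp_mixHom_self_tmul (f : S) (m : M) :
    biOp k M (mixHom k n).toLinearMap (f ⊗ₜ m) = 1 ⊗ₜ (f • m) := by
  simp [mixHom_self]

theorem biAct_diagGen_biOp_divDiff (i : Fin n) (x : S ⊗[k] M) :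
    biAct k M (diagGen k i) (biOp k M (divDiff k i) x) =
      biOp k M (mixHom k i).toLinearMap x - biOp k M (mixHom k (i + 1)).toLinearMap x := by
  induction x with
  | zero => simp
  | add x y hx hy =>
    simp only [map_add, hx, hy]
    abel
  | tmul f m =>
    simp only [biOp_tmul, biAct_biAct, diagGen_mul_divDiff, map_sub, LinearMap.sub_apply,
      AlgHom.toLinearMap_apply]

theorem biOp_divDiff_biAct_diagGen_self (i : Fin n) (x : S ⊗[k] M) :
    biOp k M (divDiff k i) (biAct k M (diagGen k i) x) =
      biOp k M (mixHom k i).toLinearMap x := by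
  induction x with
  | zero => simp
  | add x y hx hy => simp only [map_add, hx, hy]
  | tmul f m =>
    rw [biOp_biAct_diagGen_tmul, divDiff_X_mul_self, add_sub_cancel_right]
    rfl

theorem biOp_divDiff_biAct_diagGen_of_lt {i l : Fin n} (h : i < l) (x : S ⊗[k] M) :
    biOp k M (divDiff k i) (biAct k M (diagGen k l) x) =
      biAct k M (diagGen k l) (biOp k M (divDiff k i) x) := by
  induction x with
  | zero => simp
  | add x y hx hy => simp only [map_add, hx, hy]
  | tmul f m =>
    rw [biOp_biAct_diagGen_tmul, divDiff_X_mul_of_lt h, ← sub_mul, biOp_tmul, biAct_biAct]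
    rfl

theorem biOp_divDiff_biAct_diagGen_of_gt {i l : Fin n} (h : l < i) (x : S ⊗[k] M) :
    biOp k M (divDiff k i) (biAct k M (diagGen k l) x) = 0 := by
  induction x with
  | zero => simp
  | add x y hx hy => simp only [map_add, hx, hy, add_zero]
  | tmul f m =>
    rw [biOp_biAct_diagGen_tmul, divDiff_X_mul_of_gt h, sub_self, map_zero, LinearMap.zero_apply]

end Bimodule

section Components

variable (k : Type) [Field k] {n : ℕ} (M : Type) [AddCommGroup M] [Module k M]

local notation "S" => MvPolynomial (Fin n) k

/-- The basis of `Λ^p(k^n)` formed by the elements `e_I`. -/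
noncomputable def extBasis (n p : ℕ) :
    Module.Basis (Set.powersetCard (Fin n) p) k (ExtPower k n p) :=
  (Pi.basisFun k (Fin n)).exteriorPower p

theorem extBasis_apply {p : ℕ} (I : Finset (Fin n)) (h : #I = p) :
    extBasis k n p ⟨I, h⟩ = eSet k p I h := by
  refine (exteriorPower.basis_apply k p (Pi.basisFun k (Fin n)) ⟨I, h⟩).trans
    (Subtype.ext ?_)
  change ExteriorAlgebra.ιMulti k p _ = ExteriorAlgebra.ιMulti k p _
  congr 1
  funext l
  exact Pi.basisFun_apply k (Fin n) _

instance (p : ℕ) : Module.Free k (ExtPower k n p) := Module.Free.of_basis (extBasis k n p)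

/-- The inclusion `f ⊗ m ↦ f ⊗ e_I ⊗ m` of a summand of `F_p`, zero unless `I` has
cardinality `p`. -/
noncomputable def component (p : ℕ) (I : Finset (Fin n)) : S ⊗[k] M →ₗ[k] Fmod k n M p :=
  LinearMap.lTensor S
    (TensorProduct.mk k (ExtPower k n p) M (if h : #I = p then eSet k p I h else 0))

variable {k M}

theorem component_tmul {p : ℕ} {I : Finset (Fin n)} (h : #I = p) (f : S) (m : M) :
    component k M p I (f ⊗ₜ m) = f ⊗ₜ (eSet k p I h ⊗ₜ m) := by
  rw [component, dif_pos h]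
  rfl

theorem exists_desc {Q : Type*} [AddCommGroup Q] [Module k Q] (p : ℕ)
    (g : Finset (Fin n) → S ⊗[k] M →ₗ[k] Q) :
    ∃ s : Fmod k n M p →ₗ[k] Q, ∀ I x, #I = p → s (component k M p I x) = g I x := by
  refine ⟨TensorProduct.lift ((extBasis k n p).constr k fun I => g I) ∘ₗ
    (TensorProduct.leftComm k S (ExtPower k n p) M).toLinearMap, fun I x h => ?_⟩
  induction x with
  | zero => simp
  | add x y hx hy => simp only [map_add, hx, hy]
  | tmul f m =>
    rw [component_tmul h, ← extBasis_apply]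
    simp

theorem Fmod_induction {p : ℕ} {motive : Fmod k n M p → Prop}
    (component : ∀ I x, #I = p → motive (component k M p I x))
    (zero : motive 0) (add : ∀ x y, motive x → motive y → motive (x + y))
    (x : Fmod k n M p) : motive x := by
  induction x using TensorProduct.induction_on with
  | zero => exact zero
  | add x y hx hy => exact add x y hx hy
  | tmul f y =>
    induction y using TensorProduct.induction_on with
    | zero => simpa using zero
    | add x y hx hy =>
      rw [TensorProduct.tmul_add]
      exact add _ _ hx hy
    | tmul e m =>
      rw [← (extBasis k n p).sum_repr e, TensorProduct.sum_tmul, TensorProduct.tmul_sum]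
      refine Finset.sum_induction _ motive add zero ?_
      rintro ⟨I, hI : #I = p⟩ -
      have h := component I (f ⊗ₜ ((extBasis k n p).repr e ⟨I, hI⟩ • m)) hI
      rwa [component_tmul hI, ← extBasis_apply, ← TensorProduct.smul_tmul] at h

end Components

/-- Let `M` be a finitely generated module over `S = k[x_1,…,x_n]` and let
`F` be the chain complex with `F_p = S ⊗_k Λ^p(k^n) ⊗_k M` and `S`-linear differential
determined by
`d(1 ⊗ e_I ⊗ m) = Σ_{i ∈ I} (−1)^{#{j ∈ I : j < i}} (x_i ⊗ e_{I∖i} ⊗ m − 1 ⊗ e_{I∖i} ⊗ x_i·m)`.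
Then `F` is a free resolution of `M`: each `F_p` is a free `S`-module, `d ∘ d = 0`,
`H_p(F) = 0` for `p ≥ 1`, and the `S`-linear augmentation `ε : F_0 = S ⊗ M → M`,
`s ⊗ m ↦ s·m`, is surjective with kernel the image of `d_1`, so it induces `H_0(F) ≅ M`. -/
theorem stmt_0 (k : Type) [Field k] (n : ℕ)
    (M : Type) [AddCommGroup M] [Module k M]
    [Module (MvPolynomial (Fin n) k) M] [IsScalarTower k (MvPolynomial (Fin n) k) M]
    [Module.Finite (MvPolynomial (Fin n) k) M]
    -- the differential, determined on the elements `1 ⊗ e_I ⊗ m`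
    (d : ∀ p : ℕ, Fmod k n M (p + 1) →ₗ[MvPolynomial (Fin n) k] Fmod k n M p)
    (hd : ∀ (p : ℕ) (I : Finset (Fin n)) (hI : I.card = p + 1) (m : M),
      d p ((1 : MvPolynomial (Fin n) k) ⊗ₜ[k] (eSet k (p + 1) I hI ⊗ₜ[k] m)) =
        ∑ i ∈ I.attach, (-1 : ℤ) ^ (I.filter (· < ↑i)).card •
          ((X (↑i : Fin n) : MvPolynomial (Fin n) k) ⊗ₜ[k]
              (eSet k p (I.erase ↑i)
                (by simp [Finset.card_erase_of_mem i.2, hI]) ⊗ₜ[k] m)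
            - (1 : MvPolynomial (Fin n) k) ⊗ₜ[k]
              (eSet k p (I.erase ↑i)
                (by simp [Finset.card_erase_of_mem i.2, hI]) ⊗ₜ[k]
                ((X (↑i : Fin n) : MvPolynomial (Fin n) k) • m))))
    -- the augmentation `ε : F_0 → M`, `s ⊗ m ↦ s·m`
    (ε : Fmod k n M 0 →ₗ[MvPolynomial (Fin n) k] M)
    (hε : ∀ (s : MvPolynomial (Fin n) k) (m : M),
      ε (s ⊗ₜ[k] (eSet k 0 ∅ rfl ⊗ₜ[k] m)) = s • m) :
    -- `F` is a free resolution of `M`: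
    (∀ p, Module.Free (MvPolynomial (Fin n) k) (Fmod k n M p))
    ∧ (∀ (p : ℕ) (x : Fmod k n M (p + 2)), d p (d (p + 1) x) = 0)
    ∧ (∀ p : ℕ, LinearMap.ker (d p) = LinearMap.range (d (p + 1)))
    ∧ Function.Surjective ε
    ∧ LinearMap.ker ε = LinearMap.range (d 0) := by
  have hd' (p : ℕ) (I : Finset (Fin n)) (x : MvPolynomial (Fin n) k ⊗[k] M) (hI : #I = p + 1) :
      d p (component k M (p + 1) I x) =
        ∑ i ∈ I, koszulSign I i • component k M p (I.erase i) (biAct k M (diagGen k i) x) := by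
    induction x using TensorProduct.induction_on with
    | zero => simp
    | add x y hx hy => simp only [map_add, hx, hy, smul_add, Finset.sum_add_distrib]
    | tmul f m =>
      have hf : component k M (p + 1) I (f ⊗ₜ m) =
          f • ((1 : MvPolynomial (Fin n) k) ⊗ₜ[k] (eSet k (p + 1) I hI ⊗ₜ[k] m)) := by
        rw [component_tmul hI, TensorProduct.smul_tmul', smul_eq_mul, mul_one]
      rw [hf, map_smul, hd, Finset.smul_sum, ← Finset.sum_attach I]
      refine Finset.sum_congr rfl fun i _ => ?_
      have hi : #(I.erase i) = p := by simp [Finset.card_erase_of_mem i.2, hI]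
      rw [smul_comm, biAct_diagGen_tmul, map_sub, component_tmul hi, component_tmul hi, smul_sub,
        TensorProduct.smul_tmul', TensorProduct.smul_tmul', smul_eq_mul, smul_eq_mul, mul_one,
        mul_comm f]
      rfl
  choose s hs using fun p => exists_desc p fun I : Finset (Fin n) =>
    ∑ i : Fin n with ∀ a ∈ I, i < a, component k M (p + 1) (insert i I) ∘ₗ
      biOp k M (divDiff k i)
  have hs' (p : ℕ) (I : Finset (Fin n)) (x : MvPolynomial (Fin n) k ⊗[k] M) (hI : #I = p) :
      s p (component k M p I x) = ∑ i with ∀ a ∈ I, i < a,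
        component k M (p + 1) (insert i I) (biOp k M (divDiff k i) x) := by
    rw [hs p I x hI, LinearMap.sum_apply]
    rfl
  have hdd (p : ℕ) (x : Fmod k n M (p + 2)) : d p (d (p + 1) x) = 0 := by
    induction x using Fmod_induction with
    | zero => simp
    | add x y hx hy => rw [map_add, map_add, hx, hy, add_zero]
    | component I x hI =>
      exact koszul_d_comp_d (fun p I => (component k M p I).toAddMonoidHom)
        (fun i => (biAct k M (diagGen k i)).toAddMonoidHom) (fun p => (d p).toAddMonoidHom) hd'
        (fun i l x => by
          change biAct k M (diagGen k i) (biAct k M (diagGen k l) x) =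
            biAct k M (diagGen k l) (biAct k M (diagGen k i) x)
          rw [biAct_biAct, biAct_biAct, mul_comm]) p I hI x
  have hhom (p : ℕ) (x : Fmod k n M (p + 1)) : d (p + 1) (s (p + 1) x) + s p (d p x) = x := by
    induction x using Fmod_induction with
    | zero => simp
    | add x y hx hy =>
      simp only [map_add]
      rw [add_add_add_comm, hx, hy]
    | component I x hI =>
      exact koszul_homotopy (fun p I => (component k M p I).toAddMonoidHom)
        (fun i => (biAct k M (diagGen k i)).toAddMonoidHom)
        (fun i => (biOp k M (divDiff k i)).toAddMonoidHom)
        (fun i => (biOp k M (mixHom k i).toLinearMap).toAddMonoidHom)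
        (fun p => (d p).toAddMonoidHom) (fun p => (s p).toAddMonoidHom) hd' hs' biOp_mixHom_zero
        biAct_diagGen_biOp_divDiff biOp_divDiff_biAct_diagGen_self
        (fun _ _ x h => biOp_divDiff_biAct_diagGen_of_lt h x)
        (fun _ _ x h => biOp_divDiff_biAct_diagGen_of_gt h x) p I hI x
  have hε' (f : MvPolynomial (Fin n) k) (m : M) : ε (component k M 0 ∅ (f ⊗ₜ m)) = f • m := by
    rw [component_tmul Finset.card_empty, hε]
  have hhom_zero (x : Fmod k n M 0) :
      d 0 (s 0 x) = x - component k M 0 ∅ (1 ⊗ₜ ε x) := by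
    induction x using Fmod_induction with
    | zero => simp
    | add x y hx hy =>
      simp only [map_add, hx, hy, TensorProduct.tmul_add]
      abel
    | component I x hI =>
      obtain rfl := Finset.card_eq_zero.1 hI
      have h : d 0 (s 0 (component k M 0 ∅ x)) =
          component k M 0 ∅ (x - biOp k M (mixHom k n).toLinearMap x) :=
        koszul_homotopy_zero (fun p I => (component k M p I).toAddMonoidHom)
          (fun i => (biAct k M (diagGen k i)).toAddMonoidHom)
          (fun i => (biOp k M (divDiff k i)).toAddMonoidHom)
          (fun i => (biOp k M (mixHom k i).toLinearMap).toAddMonoidHom)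
          (fun p => (d p).toAddMonoidHom) (fun p => (s p).toAddMonoidHom) hd' hs'
          biOp_mixHom_zero biAct_diagGen_biOp_divDiff x
      have hx : biOp k M (mixHom k n).toLinearMap x = 1 ⊗ₜ ε (component k M 0 ∅ x) := by
        clear h
        induction x using TensorProduct.induction_on with
        | zero => simp
        | add x y hx hy => simp only [map_add, hx, hy, TensorProduct.tmul_add]
        | tmul f m => rw [biOp_mixHom_self_tmul, hε']
      rw [h, hx, map_sub]
  have hεd (x : Fmod k n M 1) : ε (d 0 x) = 0 := by
    induction x using Fmod_induction with
    | zero => simp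
    | add x y hx hy => rw [map_add, map_add, hx, hy, add_zero]
    | component I x hI =>
      obtain ⟨i, rfl⟩ := Finset.card_eq_one.1 hI
      rw [hd' 0 _ _ hI, Finset.sum_singleton, koszulSign_eq_one (by simp), one_smul,
        Finset.erase_singleton]
      induction x using TensorProduct.induction_on with
      | zero => simp
      | add x y hx hy => simp only [map_add, hx, hy, add_zero]
      | tmul f m =>
        rw [biAct_diagGen_tmul, map_sub, map_sub, hε', hε', smul_smul, mul_comm, sub_self]
  refine ⟨fun p => inferInstance, hdd, fun p => ?_, fun m => ?_, ?_⟩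
  · ext x
    refine ⟨fun hx => ⟨s (p + 1) x, ?_⟩, ?_⟩
    · have h := hhom p x
      rwa [LinearMap.mem_ker.1 hx, map_zero, add_zero] at h
    · rintro ⟨y, rfl⟩
      exact hdd p y
  · exact ⟨component k M 0 ∅ (1 ⊗ₜ m), by rw [hε', one_smul]⟩
  · ext x
    refine ⟨fun hx => ⟨s 0 x, ?_⟩, ?_⟩
    · rw [hhom_zero, LinearMap.mem_ker.1 hx, TensorProduct.tmul_zero, map_zero, sub_zero]
    · rintro ⟨y, rfl⟩
      exact hεd y
end

section
/- Let I ⊆ S be a nonzero proper monomial ideal with linear quotients with respect to the ordering m_1, ..., m_t of its minimal monomial generators, with critical-index sets A_i. Then the projective dimension of S/I as an S-module equals 1 + max_{1 ≤ i ≤ t} |A_i|. -/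
open MvPolynomial CategoryTheory

/-- The projective dimension of an `R`-module `M`: the smallest length of a projective
resolution of `M` (`⊤` if there is none).  A projective resolution `P` has length `≤ d`
when `P_p = 0` for all `p > d`. -/
noncomputable def projectiveDimension (R : Type) [Ring R]
    (M : Type) [AddCommGroup M] [Module R M] : ℕ∞ :=
  sInf { d : ℕ∞ | ∃ P : ProjectiveResolution (ModuleCat.of R M),
    ∀ p : ℕ, d < p → Limits.IsZero (P.complex.X p) }

/-! ### Koszul differentials on families indexed by finite sets -/

section Koszul

variable {n : ℕ}

/-- The sign of inserting `v` into the finite set `σ`. -/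
def insertSign (v : Fin n) (σ : Finset (Fin n)) : ℤ := (-1) ^ (σ.filter (· < v)).card

lemma insertSign_mul_self (v : Fin n) (σ : Finset (Fin n)) :
    insertSign v σ * insertSign v σ = 1 := by
  rw [insertSign, ← mul_pow]; simp

lemma insertSign_insert_mul {v w : Fin n} {σ : Finset (Fin n)} (hv : v ∉ σ) (hw : w ∉ σ)
    (h : v ≠ w) :
    insertSign w (insert v σ) * insertSign v (insert w σ)
      = -(insertSign v σ * insertSign w σ) := by
  rcases lt_or_gt_of_ne h with h | h
  · simp [insertSign, Finset.filter_insert, h, h.not_gt, hv, pow_succ, mul_comm]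
  · simp [insertSign, Finset.filter_insert, h, h.not_gt, hw, pow_succ, mul_comm]

lemma insertSign_mul_insert {v w : Fin n} {σ : Finset (Fin n)} (hv : v ∉ σ) (hw : w ∉ σ)
    (h : v ≠ w) :
    insertSign v σ * insertSign w (insert v σ)
      = -(insertSign w σ * insertSign v (insert w σ)) := by
  have h1 := insertSign_insert_mul hv hw h
  have h2 := insertSign_mul_self v (insert w σ)
  have h3 := insertSign_mul_self v σ
  linear_combination insertSign v (insert w σ) * insertSign v σ * h1
    - insertSign v σ * insertSign w (insert v σ) * h2
    - insertSign w σ * insertSign v (insert w σ) * h3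

variable {R M N : Type*} [CommRing R] [AddCommGroup M] [Module R M] [AddCommGroup N] [Module R N]

/-- The Koszul differential of the sequence `a` with coefficients in `M`; the value at `σ` is
the coefficient of the exterior monomial `e_σ`. -/
def koszul (a : Fin n → R) : (Finset (Fin n) → M) →ₗ[R] (Finset (Fin n) → M) where
  toFun c σ := ∑ v ∈ σᶜ, insertSign v σ • a v • c (insert v σ)
  map_add' c d := by
    ext σ; simp [Finset.sum_add_distrib]
  map_smul' r c := by
    ext σ
    simp only [Pi.smul_apply, Finset.smul_sum, RingHom.id_apply]
    exact Finset.sum_congr rfl fun v _ => by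
      rw [smul_comm (a v) r, smul_comm (insertSign v σ) r]

lemma koszul_apply (a : Fin n → R) (c : Finset (Fin n) → M) (σ : Finset (Fin n)) :
    koszul a c σ = ∑ v ∈ σᶜ, insertSign v σ • a v • c (insert v σ) := rfl

lemma koszul_comp (a : Fin n → R) (f : M →ₗ[R] N) (c : Finset (Fin n) → M) :
    koszul a (fun σ => f (c σ)) = fun σ => f (koszul a c σ) := by
  ext σ
  simp [koszul_apply]

lemma koszul_koszul (a : Fin n → R) (c : Finset (Fin n) → M) : koszul a (koszul a c) = 0 := by
  ext σ
  simp only [koszul_apply, Finset.smul_sum, Pi.zero_apply]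
  rw [Finset.sum_sigma']
  refine Finset.sum_involution (fun p _ => ⟨p.2, p.1⟩) ?_ ?_ ?_ ?_
  · rintro ⟨v, w⟩ h
    simp only [Finset.mem_sigma, Finset.mem_compl, Finset.mem_insert, not_or] at h
    obtain ⟨hv, hwv, hw⟩ := h
    have := insertSign_mul_insert hv hw (Ne.symm hwv)
    simp only [smul_comm (a _) (insertSign _ _), smul_smul, this, Finset.insert_comm w v,
      mul_comm (a w)]
    simp
  · rintro ⟨v, w⟩ h _
    simp only [Finset.mem_sigma, Finset.mem_compl, Finset.mem_insert, not_or] at h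
    intro h'
    simp only [Sigma.mk.injEq] at h'
    exact h.2.1 h'.1
  · rintro ⟨v, w⟩ h
    simp only [Finset.mem_sigma, Finset.mem_compl, Finset.mem_insert, not_or] at h ⊢
    exact ⟨h.2.2, Ne.symm h.2.1, h.1⟩
  · intros; rfl

/-- The part of a family supported on finite sets with `j` elements. -/
def degreePart (j : ℕ) (c : Finset (Fin n) → M) (σ : Finset (Fin n)) : M :=
  if σ.card = j then c σ else 0

lemma koszul_degreePart (a : Fin n → R) (j : ℕ) (c : Finset (Fin n) → M) :
    koszul a (degreePart (j + 1) c) = degreePart j (koszul a c) := by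
  ext σ
  by_cases h : σ.card = j
  · simp only [degreePart, h, if_true, koszul_apply]
    refine Finset.sum_congr rfl fun v hv => ?_
    rw [Finset.card_insert_of_notMem (by simpa using hv), if_pos (by omega)]
  · simp only [degreePart, h, if_false, koszul_apply]
    refine Finset.sum_eq_zero fun v hv => ?_
    rw [Finset.card_insert_of_notMem (by simpa using hv), if_neg (by omega)]
    simp

lemma degreePart_eq_self {j : ℕ} {c : Finset (Fin n) → M} (h : ∀ σ, σ.card ≠ j → c σ = 0) :
    degreePart j c = c := by
  ext σ
  by_cases hσ : σ.card = j
  · simp [degreePart, hσ]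
  · simp [degreePart, hσ, h σ hσ]

/-- The cone operator with apex `v`. -/
def cone (v : Fin n) (c : Finset (Fin n) → M) (σ : Finset (Fin n)) : M :=
  if v ∈ σ then insertSign v (σ.erase v) • c (σ.erase v) else 0

lemma koszul_cone_add_cone_koszul (v : Fin n) (c : Finset (Fin n) → M) :
    koszul (1 : Fin n → R) (cone v c) + cone v (koszul (1 : Fin n → R) c) = c := by
  ext σ
  by_cases hv : v ∈ σ
  · obtain ⟨ρ, hρ, rfl⟩ : ∃ ρ, v ∉ ρ ∧ σ = insert v ρ :=
      ⟨σ.erase v, by simp, (Finset.insert_erase hv).symm⟩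
    have hc : ρᶜ = insert v (insert v ρ)ᶜ := by
      ext w; by_cases h : w = v <;> simp [h, hρ]
    simp only [Pi.add_apply, koszul_apply, cone, Finset.mem_insert, true_or, or_true, if_true,
      Finset.erase_insert hρ, Pi.one_apply, one_smul]
    rw [hc, Finset.sum_insert (by simp), smul_add, smul_smul, insertSign_mul_self, one_smul,
      Finset.smul_sum, add_left_comm, ← Finset.sum_add_distrib, Finset.sum_eq_zero, add_zero]
    intro w hw
    simp only [Finset.mem_compl, Finset.mem_insert, not_or] at hw
    rw [Finset.insert_comm w v, Finset.erase_insert (by simp [hρ, Ne.symm hw.1]), smul_smul,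
      smul_smul, insertSign_insert_mul hρ hw.2 (Ne.symm hw.1), ← add_smul, neg_add_cancel,
      zero_smul]
  · simp only [Pi.add_apply, koszul_apply, cone, hv, if_false, add_zero, Pi.one_apply, one_smul,
      Finset.mem_insert, or_false]
    rw [Finset.sum_eq_single v]
    · simp [Finset.erase_insert hv, smul_smul, insertSign_mul_self]
    · intro w _ hw
      simp [Ne.symm hw]
    · intro h; simp [hv] at h

lemma koszul_cone (v : Fin n) {c : Finset (Fin n) → M} (h : koszul (1 : Fin n → R) c = 0) :
    koszul (1 : Fin n → R) (cone v c) = c := by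
  have := koszul_cone_add_cone_koszul (R := R) v c
  rw [h] at this
  convert this using 1
  ext σ; simp [cone]

end Koszul

/-! ### The upper Koszul complexes of an ideal with linear quotients -/

section UpperKoszul

variable {n t : ℕ}

/-- The exponent vector of the squarefree monomial with support `σ`. -/
noncomputable def sqfreeExp (σ : Finset (Fin n)) : Fin n →₀ ℕ := Finsupp.indicator σ fun _ _ => 1

lemma sqfreeExp_apply (σ : Finset (Fin n)) (x : Fin n) :
    sqfreeExp σ x = if x ∈ σ then 1 else 0 := by
  simp [sqfreeExp, Finsupp.indicator_apply]

lemma sqfreeExp_insert {v : Fin n} {σ : Finset (Fin n)} (h : v ∉ σ) :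
    sqfreeExp (insert v σ) = sqfreeExp σ + Finsupp.single v 1 := by
  ext x
  by_cases hx : x = v
  · subst hx; simp [sqfreeExp_apply, h]
  · simp [sqfreeExp_apply, hx]

lemma sqfreeExp_mono {σ τ : Finset (Fin n)} (h : σ ⊆ τ) : sqfreeExp σ ≤ sqfreeExp τ := by
  intro x
  rw [sqfreeExp_apply, sqfreeExp_apply]
  split_ifs with h1 h2 <;> first | omega | exact absurd (h h1) h2

/-- `σ` is a face of the upper Koszul complex in degree `u` of the ideal generated by the first
`r` monomials of the family with exponents `m`. -/
def IsFace (m : Fin t → (Fin n →₀ ℕ)) (u : Fin n →₀ ℕ) (r : ℕ) (σ : Finset (Fin n)) : Prop :=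
  ∃ l : Fin t, l.val < r ∧ m l + sqfreeExp σ ≤ u

variable {m : Fin t → (Fin n →₀ ℕ)} {u : Fin n →₀ ℕ} {r : ℕ} {σ : Finset (Fin n)}

lemma IsFace.subset {τ : Finset (Fin n)} (h : IsFace m u r τ) (hs : σ ⊆ τ) : IsFace m u r σ := by
  obtain ⟨l, hl, h⟩ := h
  exact ⟨l, hl, (add_le_add_right (sqfreeExp_mono hs) _).trans h⟩

lemma IsFace.mono {s : ℕ} (h : IsFace m u r σ) (hrs : r ≤ s) : IsFace m u s σ := by
  obtain ⟨l, hl, h⟩ := h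
  exact ⟨l, hl.trans_le hrs, h⟩

lemma IsFace.le (h : IsFace m u r σ) : sqfreeExp σ ≤ u := by
  obtain ⟨l, -, h⟩ := h
  exact le_trans (by simp) h

/-- A set `σ` with `u = m l + σ` is a facet of the upper Koszul complex in degree `u`. -/
lemma not_isFace_insert (hmin : ∀ i j : Fin t, i ≠ j → ¬ m i ≤ m j) {l : Fin t} {v : Fin n}
    (hv : v ∉ σ) : ¬ IsFace m (m l + sqfreeExp σ) r (insert v σ) := by
  rintro ⟨p, -, hp⟩
  rw [sqfreeExp_insert hv, add_comm (sqfreeExp σ), ← add_assoc] at hp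
  have hp := le_of_add_le_add_right hp
  have : p = l := by
    by_contra hne
    exact hmin p l hne (le_trans (by simp) hp)
  subst this
  have := hp v
  simp at this

variable {k : Type*} [Field k]

lemma koszul_apply_eq_zero_of_facet (hmin : ∀ i j : Fin t, i ≠ j → ¬ m i ≤ m j)
    {w : Finset (Fin n) → k} (hw : ∀ σ, w σ ≠ 0 → IsFace m u r σ) {l : Fin t}
    (hu : u = m l + sqfreeExp σ) : koszul (1 : Fin n → k) w σ = 0 := by
  rw [koszul_apply]
  refine Finset.sum_eq_zero fun v hv => ?_
  have : w (insert v σ) = 0 := by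
    by_contra h
    exact not_isFace_insert hmin (by simpa using hv) (hu ▸ hw _ h)
  simp [this]

lemma exists_insert_of_koszul_ne_zero {z : Finset (Fin n) → k}
    (h : koszul (1 : Fin n → k) z σ ≠ 0) : ∃ v ∉ σ, z (insert v σ) ≠ 0 := by
  obtain ⟨v, hv, h⟩ := Finset.exists_ne_zero_of_sum_ne_zero (koszul_apply (1 : Fin n → k) z σ ▸ h)
  refine ⟨v, by simpa using hv, fun h0 => h ?_⟩
  simp [h0]

/-- The exponents `m` have linear quotients with critical sets `A`. -/
structure HasLinearQuotients (m : Fin t → (Fin n →₀ ℕ)) (A : Fin t → Finset (Fin n)) : Prop where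
  exists_le : ∀ r, ∀ a ∈ A r, ∃ l < r, m l ≤ m r + Finsupp.single a 1
  exists_lt : ∀ r, ∀ l < r, ∃ a ∈ A r, m r a < m l a

variable {A : Fin t → Finset (Fin n)}

lemma HasLinearQuotients.isFace_iff (hA : HasLinearQuotients m A) (r : Fin t)
    (h : m r + sqfreeExp σ ≤ u) :
    IsFace m u r σ ↔ ∃ a ∈ A r, (m r + sqfreeExp σ) a < u a := by
  constructor
  · rintro ⟨l, hl, hlu⟩
    obtain ⟨a, ha, hlt⟩ := hA.exists_lt r l hl
    have := hlu a
    simp only [Finsupp.add_apply] at this ⊢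
    exact ⟨a, ha, by omega⟩
  · rintro ⟨a, ha, hlt⟩
    obtain ⟨l, hl, hle⟩ := hA.exists_le r a ha
    refine ⟨l, hl, fun x => ?_⟩
    have h1 := hle x
    have h2 := h x
    by_cases hx : x = a
    · subst hx
      simp at h1 h2 hlt ⊢
      omega
    · simp [Ne.symm hx] at h1 h2 hlt ⊢
      omega

/-- In an ideal with linear quotients, every cycle of an upper Koszul complex which vanishes at
the facets `σ` with `u = m l + σ` is a boundary. -/
lemma HasLinearQuotients.exists_koszul_eq (hA : HasLinearQuotients m A)
    (hmin : ∀ i j : Fin t, i ≠ j → ¬ m i ≤ m j) (hr : r ≤ t) {z : Finset (Fin n) → k}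
    (hz : koszul (1 : Fin n → k) z = 0) (hface : ∀ σ, z σ ≠ 0 → IsFace m u r σ)
    (hfacet : ∀ σ l, u = m l + sqfreeExp σ → z σ = 0) :
    ∃ w : Finset (Fin n) → k, koszul (1 : Fin n → k) w = z ∧ ∀ σ, w σ ≠ 0 → IsFace m u r σ := by
  induction r generalizing z with
  | zero =>
    refine ⟨0, ?_, by simp⟩
    rw [map_zero]
    ext σ
    by_contra h
    obtain ⟨l, hl, -⟩ := hface σ (Ne.symm h)
    omega
  | succ r ih =>
    let q : Fin t := ⟨r, hr⟩
    have hnew : ∀ σ, IsFace m u (r + 1) σ → ¬ IsFace m u r σ → m q + sqfreeExp σ ≤ u := by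
      rintro σ ⟨l, hl, h⟩ hn
      have : l = q := by
        ext
        by_contra hne
        exact hn ⟨l, lt_of_le_of_ne (Nat.lt_succ_iff.mp hl) hne, h⟩
      exact this ▸ h
    by_cases hv : ∃ v ∉ A q, m q v < u v
    · obtain ⟨v, hvA, hvu⟩ := hv
      have hins : ∀ σ, m q + sqfreeExp σ ≤ u → m q + sqfreeExp (insert v σ) ≤ u := by
        intro σ h x
        by_cases hx : x = v
        · subst hx; simp [sqfreeExp_apply]; omega
        · simpa [sqfreeExp_apply, hx] using h x
      have hold : ∀ σ, m q + sqfreeExp σ ≤ u →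
          (IsFace m u r (insert v σ) ↔ IsFace m u r σ) := by
        intro σ h
        rw [hA.isFace_iff q h, hA.isFace_iff q (hins σ h)]
        refine exists_congr fun a => and_congr_right fun ha => ?_
        have : a ≠ v := fun h => hvA (h ▸ ha)
        simp [sqfreeExp_apply, this]
      classical
      let y : Finset (Fin n) → k := fun σ => if IsFace m u r σ then 0 else z σ
      have hy : ∀ σ, y σ ≠ 0 → ¬ IsFace m u r σ ∧ m q + sqfreeExp σ ≤ u := by
        intro σ h
        have h1 : ¬ IsFace m u r σ := fun h1 => h (by simp [y, h1])
        have h2 : z σ ≠ 0 := fun h2 => h (by simp [y, h2])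
        exact ⟨h1, hnew σ (hface σ h2) h1⟩
      have hzy : ∀ σ, (z - y) σ ≠ 0 → IsFace m u r σ := by
        intro σ h
        by_contra h1
        exact h (by simp [y, h1])
      have hw : ∀ σ, cone v y σ ≠ 0 → IsFace m u (r + 1) σ := by
        intro σ h
        have hvσ : v ∈ σ := by
          by_contra h1
          exact h (by simp [cone, h1])
        have h1 : y (σ.erase v) ≠ 0 := fun h0 => h (by simp [cone, h0])
        refine ⟨q, Nat.lt_succ_self r, ?_⟩
        have := hins _ (hy _ h1).2
        rwa [Finset.insert_erase hvσ] at this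
      have hker : koszul (1 : Fin n → k) (z - koszul (1 : Fin n → k) (cone v y)) = 0 := by
        rw [map_sub, koszul_koszul, hz, sub_zero]
      have hdy : koszul (1 : Fin n → k) (z - y) = - koszul (1 : Fin n → k) y := by
        rw [map_sub, hz, zero_sub]
      have hsub : z - koszul (1 : Fin n → k) (cone v y)
          = (z - y) + cone v (koszul (1 : Fin n → k) y) := by
        nth_rewrite 2 [← koszul_cone_add_cone_koszul (R := k) v y]
        abel
      obtain ⟨w, hw1, hw2⟩ := ih (by omega) hker (by
        intro σ h
        by_cases h1 : (z - y) σ ≠ 0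
        · exact hzy σ h1
        rw [not_not] at h1
        rw [hsub, Pi.add_apply, h1, zero_add] at h
        have hvσ : v ∈ σ := by
          by_contra h1
          exact h (by simp [cone, h1])
        have h2 : koszul (1 : Fin n → k) y (σ.erase v) ≠ 0 := fun h0 => h (by simp [cone, h0])
        obtain ⟨x, -, hx⟩ := exists_insert_of_koszul_ne_zero h2
        have h3 : m q + sqfreeExp (σ.erase v) ≤ u :=
          (add_le_add_right (sqfreeExp_mono (Finset.subset_insert _ _)) _).trans (hy _ hx).2
        have h4 : koszul (1 : Fin n → k) (z - y) (σ.erase v) ≠ 0 := by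
          rw [hdy]; simpa using h2
        obtain ⟨x', -, hx'⟩ := exists_insert_of_koszul_ne_zero h4
        have := (hold _ h3).2 ((hzy _ hx').subset (Finset.subset_insert _ _))
        rwa [Finset.insert_erase hvσ] at this) (by
        intro σ l hl
        rw [Pi.sub_apply, hfacet σ l hl, koszul_apply_eq_zero_of_facet hmin hw hl, sub_zero])
      refine ⟨w + cone v y, by rw [map_add, hw1, sub_add_cancel], fun σ h => ?_⟩
      by_cases h1 : w σ = 0
      · rw [Pi.add_apply, h1, zero_add] at h
        exact hw σ h
      · exact (hw2 σ h1).mono (Nat.le_succ r)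
    · push Not at hv
      obtain ⟨w, hw1, hw2⟩ := ih (by omega) hz (by
        intro σ h
        by_contra hn
        have hle := hnew σ (hface σ h) hn
        refine h (hfacet σ q (le_antisymm (fun x => ?_) hle))
        rw [hA.isFace_iff q hle] at hn
        push Not at hn
        by_cases hx : x ∈ A q
        · exact hn x hx
        · exact (hv x hx).trans (by simp)) hfacet
      exact ⟨w, hw1, fun σ h => (hw2 σ h).mono (Nat.le_succ r)⟩

/-- In an ideal with linear quotients, each critical set `A i` is a facet with coefficient `1`
in a cycle of the upper Koszul complex in degree `m i + A i`. -/
lemma HasLinearQuotients.exists_cycle (k : Type*) [Field k] (hA : HasLinearQuotients m A)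
    (hmin : ∀ i j : Fin t, i ≠ j → ¬ m i ≤ m j) (i : Fin t) :
    ∃ y : Finset (Fin n) → k, koszul (1 : Fin n → k) y = 0 ∧ y (A i) = 1 ∧
      (∀ σ, y σ ≠ 0 → IsFace m (m i + sqfreeExp (A i)) t σ) ∧
      ∀ σ, σ.card ≠ (A i).card → y σ = 0 := by
  classical
  let e : Finset (Fin n) → k := Pi.single (A i) 1
  have he : ∀ σ, e σ ≠ 0 → σ = A i := fun σ h => by
    by_contra h1
    exact h (by simp [e, h1])
  have hef : ∀ σ, e σ ≠ 0 → IsFace m (m i + sqfreeExp (A i)) t σ := fun σ h =>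
    ⟨i, i.2, by rw [he σ h]⟩
  obtain ⟨w, hw1, hw2⟩ := hA.exists_koszul_eq (r := i) (u := m i + sqfreeExp (A i)) hmin i.2.le
    (koszul_koszul (1 : Fin n → k) e) (by
      intro σ h
      obtain ⟨v, hv, h⟩ := exists_insert_of_koszul_ne_zero h
      have h := he _ h
      have hle : m i + sqfreeExp σ ≤ m i + sqfreeExp (A i) :=
        add_le_add_right (sqfreeExp_mono (h ▸ Finset.subset_insert _ _)) _
      refine (hA.isFace_iff i hle).2 ⟨v, h ▸ Finset.mem_insert_self _ _, ?_⟩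
      simp [← h, sqfreeExp_apply, hv])
    (fun σ l hl => koszul_apply_eq_zero_of_facet hmin hef hl)
  have hwA : w (A i) = 0 := by
    by_contra h
    obtain ⟨a, -, ha⟩ := (hA.isFace_iff i le_rfl).1 (hw2 _ h)
    exact lt_irrefl _ ha
  have hez : koszul (1 : Fin n → k) (e - w) = 0 := by rw [map_sub, hw1, sub_self]
  refine ⟨degreePart (A i).card (e - w), ?_, by simp [degreePart, hwA, e], ?_,
    fun σ h => by simp [degreePart, h]⟩
  · rcases h : (A i).card with _ | j
    · ext σ
      rw [koszul_apply]
      refine Finset.sum_eq_zero fun v hv => ?_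
      simp [degreePart]
    · rw [koszul_degreePart, hez]
      ext σ; simp [degreePart]
  · intro σ h
    have h : (e - w) σ ≠ 0 := fun h0 => h (by simp [degreePart, h0])
    by_cases h1 : e σ = 0
    · exact (hw2 σ fun h0 => h (by simp [h0, h1])).mono i.2.le
    · exact hef σ h1

end UpperKoszul

/-! ### Vanishing of Koszul homology -/

section Acyclic

variable {n : ℕ}

/-- The Koszul homology of `M` with respect to the sequence `a` vanishes in degree `j`. -/
def KoszulAcyclic {R : Type*} [CommRing R] (a : Fin n → R) (M : Type*) [AddCommGroup M]
    [Module R M] (j : ℕ) : Prop :=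
  ∀ c : Finset (Fin n) → M, (∀ σ, σ.card ≠ j → c σ = 0) → koszul a c = 0 →
    ∃ b : Finset (Fin n) → M, koszul a b = c

variable {k : Type*} [Field k]

/-- The homogeneous Koszul chain of multidegree `u` over the polynomial ring with given
coefficients. -/
noncomputable def monomialChain (u : Fin n →₀ ℕ) (z : Finset (Fin n) → k) (σ : Finset (Fin n)) :
    MvPolynomial (Fin n) k :=
  monomial (u - sqfreeExp σ) (z σ)

lemma koszul_monomialChain {u : Fin n →₀ ℕ} {z : Finset (Fin n) → k}
    (hz : ∀ σ, z σ ≠ 0 → sqfreeExp σ ≤ u) :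
    koszul (X : Fin n → MvPolynomial (Fin n) k) (monomialChain u z)
      = monomialChain u (koszul (1 : Fin n → k) z) := by
  ext1 σ
  simp only [monomialChain, koszul_apply, map_sum, Pi.one_apply, one_smul, map_zsmul]
  refine Finset.sum_congr rfl fun v hv => ?_
  congr 1
  by_cases h : z (insert v σ) = 0
  · simp [h]
  have hle := hz _ h
  rw [X, smul_eq_mul, monomial_mul, one_mul]
  congr 2
  rw [sqfreeExp_insert (by simpa using hv)] at hle ⊢
  rw [← tsub_tsub, add_tsub_cancel_of_le]
  exact le_tsub_of_add_le_left hle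

/-- The coefficients of the component of multidegree `u` of a Koszul chain over the polynomial
ring. -/
noncomputable def strand (u : Fin n →₀ ℕ) (c : Finset (Fin n) → MvPolynomial (Fin n) k)
    (σ : Finset (Fin n)) : k :=
  open Classical in if sqfreeExp σ ≤ u then coeff (u - sqfreeExp σ) (c σ) else 0

lemma strand_ne_zero {u : Fin n →₀ ℕ} {c : Finset (Fin n) → MvPolynomial (Fin n) k}
    {σ : Finset (Fin n)} (h : strand u c σ ≠ 0) :
    sqfreeExp σ ≤ u ∧ coeff (u - sqfreeExp σ) (c σ) ≠ 0 := by
  unfold strand at h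
  split_ifs at h with h1
  · exact ⟨h1, h⟩
  · exact absurd rfl h

lemma koszul_strand (u : Fin n →₀ ℕ) (c : Finset (Fin n) → MvPolynomial (Fin n) k) :
    koszul (1 : Fin n → k) (strand u c)
      = strand u (koszul (X : Fin n → MvPolynomial (Fin n) k) c) := by
  ext σ
  by_cases h : sqfreeExp σ ≤ u
  · simp only [koszul_apply, strand, h, if_true, coeff_sum, Pi.one_apply, one_smul]
    refine Finset.sum_congr rfl fun v hv => ?_
    have hv : v ∉ σ := by simpa using hv
    refine Eq.trans ?_ (map_zsmul (lcoeff k (u - sqfreeExp σ)) _ _).symm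
    rw [lcoeff_apply, smul_eq_mul, coeff_X_mul', sqfreeExp_insert hv]
    congr 1
    have : sqfreeExp σ + Finsupp.single v 1 ≤ u ↔ v ∈ (u - sqfreeExp σ).support := by
      rw [Finsupp.mem_support_iff]
      simp only [Finsupp.tsub_apply, sqfreeExp_apply, hv, if_false, tsub_zero]
      constructor
      · intro h; have := h v; simp at this; omega
      · intro h0 x
        have := h x
        by_cases hx : x = v
        · subst hx; simp [sqfreeExp_apply, hv]; omega
        · simpa [Ne.symm hx] using this
    simp only [this, tsub_tsub]
  · rw [koszul_apply]
    simp only [strand, h, if_false]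
    refine Finset.sum_eq_zero fun v hv => ?_
    rw [if_neg fun h1 => h ((sqfreeExp_mono (Finset.subset_insert _ _)).trans h1)]
    simp

variable (n k) in
lemma koszulAcyclic_mvPolynomial {j : ℕ} (hj : 0 < j) :
    KoszulAcyclic (X : Fin n → MvPolynomial (Fin n) k) (MvPolynomial (Fin n) k) j := by
  classical
  intro c hc hker
  let U : Finset (Fin n →₀ ℕ) :=
    Finset.univ.biUnion fun σ => (c σ).support.image (· + sqfreeExp σ)
  have hstrand : ∀ u, ∃ w : Finset (Fin n) → k, koszul (1 : Fin n → k) w = strand u c ∧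
      ∀ σ, w σ ≠ 0 → sqfreeExp σ ≤ u := by
    intro u
    by_cases hu : u = 0
    · refine ⟨0, ?_, by simp⟩
      rw [map_zero]
      ext σ
      by_contra h
      have h := strand_ne_zero (Ne.symm h)
      rw [hu] at h
      have hσ : σ = ∅ := by
        by_contra hne
        obtain ⟨x, hx⟩ := Finset.nonempty_iff_ne_empty.mpr hne
        have := h.1 x
        simp [sqfreeExp_apply, hx] at this
      rw [hc σ (by simp [hσ]; omega)] at h
      simp at h
    · obtain ⟨v, hv⟩ := Finsupp.ne_iff.mp hu
      refine ⟨cone v (strand u c), koszul_cone v ?_, ?_⟩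
      · rw [koszul_strand, hker]
        ext σ; simp [strand]
      · intro σ h x
        have h1 : strand u c (σ.erase v) ≠ 0 := fun h0 => h (by simp [cone, h0])
        have h2 := (strand_ne_zero h1).1 x
        by_cases hx : x = v
        · subst hx
          simp at hv
          rw [sqfreeExp_apply]; split_ifs <;> omega
        · simpa [sqfreeExp_apply, hx] using h2
  choose w hw1 hw2 using hstrand
  refine ⟨∑ u ∈ U, monomialChain u (w u), ?_⟩
  rw [map_sum]
  simp only [koszul_monomialChain (hw2 _), hw1]
  ext σ α
  simp only [Finset.sum_apply, coeff_sum, monomialChain, coeff_monomial]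
  rw [Finset.sum_eq_single (α + sqfreeExp σ)]
  · simp [strand]
  · intro u _ hne
    split_ifs with h
    · by_contra h0
      refine hne ?_
      rw [← h, tsub_add_cancel_of_le (strand_ne_zero h0).1]
    · rfl
  · intro h
    by_contra h0
    refine h ?_
    simp only [add_tsub_cancel_right, if_true] at h0
    simp only [U, Finset.mem_biUnion, Finset.mem_image, Finset.mem_univ, true_and]
    refine ⟨σ, α, ?_, rfl⟩
    have := (strand_ne_zero h0).2
    rwa [add_tsub_cancel_right, ← mem_support_iff] at this

variable {R : Type*} [CommRing R] {a : Fin n → R} {M N : Type*} [AddCommGroup M] [Module R M]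
  [AddCommGroup N] [Module R N] {j : ℕ}

lemma KoszulAcyclic.finsupp (h : KoszulAcyclic a R j) (ι : Type*) : KoszulAcyclic a (ι →₀ R) j := by
  classical
  intro c hc hker
  have hi : ∀ i, ∃ b : Finset (Fin n) → R, koszul a b = fun σ => c σ i := by
    intro i
    refine h _ (fun σ hσ => by simp [hc σ hσ]) ?_
    have := koszul_comp a (Finsupp.lapply i : (ι →₀ R) →ₗ[R] R) c
    rw [hker] at this
    ext σ
    simpa using congrFun this σ
  choose b hb using hi
  let U : Finset ι := Finset.univ.biUnion fun σ => (c σ).support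
  refine ⟨fun σ => ∑ i ∈ U, Finsupp.single i (b i σ), ?_⟩
  have : (fun σ => ∑ i ∈ U, Finsupp.single i (b i σ))
      = ∑ i ∈ U, fun σ => (Finsupp.lsingle i : R →ₗ[R] ι →₀ R) (b i σ) := by
    ext1 σ; simp
  rw [this, map_sum]
  simp only [koszul_comp, hb]
  ext1 σ
  simp only [Finset.sum_apply, Finsupp.lsingle_apply]
  refine (Finset.sum_subset (s₁ := (c σ).support) ?_ ?_).symm.trans (Finsupp.sum_single (c σ))
  · exact Finset.subset_biUnion_of_mem (fun σ => (c σ).support) (Finset.mem_univ σ)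
  · intro i _ hi
    simp [Finsupp.notMem_support_iff.mp hi]

lemma KoszulAcyclic.of_projective (h : KoszulAcyclic a R j) [Module.Projective R M] :
    KoszulAcyclic a M j := by
  intro c hc hker
  obtain ⟨s, hs⟩ := Module.projective_def'.mp (inferInstance : Module.Projective R M)
  obtain ⟨b, hb⟩ := h.finsupp M (fun σ => s (c σ)) (fun σ hσ => by simp [hc σ hσ]) (by
    rw [koszul_comp, hker]; ext1 σ; simp)
  refine ⟨fun σ => Finsupp.linearCombination R id (b σ), ?_⟩
  rw [koszul_comp, hb]
  ext1 σ
  exact LinearMap.congr_fun hs (c σ)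

lemma KoszulAcyclic.of_surjective {f : M →ₗ[R] N} (hf : Function.Surjective f)
    (hM : KoszulAcyclic a M (j + 1)) (hK : KoszulAcyclic a (LinearMap.ker f) j) :
    KoszulAcyclic a N (j + 1) := by
  classical
  intro c hc hker
  choose g hg using hf
  let e : Finset (Fin n) → M := degreePart (j + 1) fun σ => g (c σ)
  have he : (fun σ => f (e σ)) = c := by
    ext1 σ
    by_cases h : σ.card = j + 1
    · simp [e, degreePart, h, hg]
    · simp [e, degreePart, h, hc σ h]
  have hde : ∀ σ, f (koszul a e σ) = 0 := fun σ => by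
    have := congrFun (koszul_comp a f e) σ
    rw [he, hker] at this
    exact this.symm
  have hdeg : degreePart j (koszul a e) = koszul a e := by
    rw [← koszul_degreePart, degreePart_eq_self fun σ h => by simp [e, degreePart, h]]
  obtain ⟨w, hw⟩ := hK (fun σ => ⟨koszul a e σ, hde σ⟩) (fun σ h => by
      rw [Subtype.ext_iff]
      change koszul a e σ = 0
      rw [← hdeg, degreePart, if_neg h]) (by
      ext σ
      have := congrFun (koszul_comp a (LinearMap.ker f).subtype
        fun σ => ⟨koszul a e σ, hde σ⟩) σ
      exact this.symm.trans (congrFun (koszul_koszul a e) σ))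
  have hw' : koszul a (fun σ => (w σ : M)) = koszul a e := by
    have := koszul_comp a (LinearMap.ker f).subtype w
    rw [hw] at this
    exact this
  obtain ⟨b, hb⟩ := hM (e - degreePart (j + 1) fun σ => (w σ : M))
    (fun σ h => by simp [e, degreePart, h]) (by
      rw [map_sub, koszul_degreePart a j (fun σ => (w σ : M)), hw', hdeg, sub_self])
  refine ⟨fun σ => f (b σ), ?_⟩
  rw [koszul_comp, hb, ← he]
  ext1 σ
  have : f (degreePart (j + 1) (fun σ => (w σ : M)) σ) = 0 := by
    unfold degreePart
    split_ifs
    · exact (w σ).2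
    · simp
  rw [Pi.sub_apply, map_sub, this, sub_zero]

end Acyclic

section ProjectiveDimension

variable {n : ℕ}

universe u

lemma koszulAcyclic_of_hasProjectiveDimensionLT {R : Type u} [CommRing R] {a : Fin n → R}
    (hR : ∀ j, 0 < j → KoszulAcyclic a R j) (N : ℕ) (M : ModuleCat.{u} R)
    (hM : HasProjectiveDimensionLT M (N + 1)) {j : ℕ} (hj : N < j) : KoszulAcyclic a M j := by
  induction N generalizing M j with
  | zero =>
    have : Module.Projective R M :=
      (IsProjective.iff_projective M).2 (projective_iff_hasProjectiveDimensionLT_one.2 hM)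
    exact (hR j hj).of_projective
  | succ N ih =>
    obtain ⟨j, rfl⟩ : ∃ i, j = i + 1 := ⟨j - 1, by omega⟩
    have hS := M.shortExact_projectiveShortComplex
    have hK := (hS.hasProjectiveDimensionLT_X₃_iff N inferInstance).1 hM
    have hX : Module.Projective R M.projectiveShortComplex.X₂ :=
      (IsProjective.iff_projective _).2 inferInstance
    exact KoszulAcyclic.of_surjective (f := M.projectiveShortComplex.g.hom)
      ((ModuleCat.epi_iff_surjective _).1 hS.epi_g) ((hR _ (by omega)).of_projective)
      (ih _ hK (by omega))

end ProjectiveDimension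

section LowerBound

variable {n t : ℕ} {k : Type*} [Field k] {m : Fin t → (Fin n →₀ ℕ)} {A : Fin t → Finset (Fin n)}

lemma HasLinearQuotients.not_koszulAcyclic (hA : HasLinearQuotients m A)
    (hmin : ∀ i j : Fin t, i ≠ j → ¬ m i ≤ m j) (i : Fin t) (hi : m i ≠ 0) :
    ¬ KoszulAcyclic (X : Fin n → MvPolynomial (Fin n) k)
      (MvPolynomial (Fin n) k ⧸ Ideal.span (Set.range fun i => monomial (m i) (1 : k)))
      ((A i).card + 1) := by
  intro hac
  set I := Ideal.span (Set.range fun i => monomial (m i) (1 : k)) with hI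
  have hmem : ∀ p : MvPolynomial (Fin n) k, p ∈ I ↔ ∀ α ∈ p.support, ∃ l, m l ≤ α := by
    intro p
    have : (Set.range fun i => (monomial (m i) (1 : k) : MvPolynomial (Fin n) k))
        = (fun s => (monomial s (1 : k) : MvPolynomial (Fin n) k)) '' Set.range m := by
      rw [← Set.range_comp]; rfl
    rw [hI, this, mem_ideal_span_monomial_image]
    simp
  obtain ⟨y, hy, hyA, hyface, hycard⟩ := hA.exists_cycle k hmin i
  obtain ⟨v, hv⟩ := Finsupp.ne_iff.mp hi
  simp only [Finsupp.coe_zero, Pi.zero_apply] at hv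
  set u := m i + sqfreeExp (A i) with hu
  have hb : ∀ σ, cone v y σ ≠ 0 → y (σ.erase v) ≠ 0 ∧ v ∈ σ := by
    intro σ h
    refine ⟨fun h0 => h (by simp [cone, h0]), ?_⟩
    by_contra h1
    exact h (by simp [cone, h1])
  have hble : ∀ σ, cone v y σ ≠ 0 → sqfreeExp σ ≤ u := by
    intro σ h x
    have h2 := (hyface _ (hb σ h).1).le x
    by_cases hx : x = v
    · subst hx
      simp only [hu, sqfreeExp_apply, Finsupp.add_apply]; split_ifs <;> omega
    · simpa [sqfreeExp_apply, hx] using h2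
  let e : Finset (Fin n) → MvPolynomial (Fin n) k := monomialChain u (cone v y)
  have he : koszul (X : Fin n → MvPolynomial (Fin n) k) e = monomialChain u y := by
    rw [koszul_monomialChain hble, koszul_cone v hy]
  have hmonI : ∀ σ, monomialChain u y σ ∈ I := by
    intro σ
    rw [hmem]
    intro α hα
    rw [monomialChain, mem_support_iff, coeff_monomial] at hα
    split_ifs at hα with h
    · obtain ⟨l, -, hl⟩ := hyface σ hα
      exact ⟨l, h ▸ le_tsub_of_add_le_right hl⟩
    · exact absurd rfl hα
  obtain ⟨g, hg⟩ := hac (fun σ => I.mkQ (e σ)) (by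
      intro σ h
      have : cone v y σ = 0 := by
        by_contra h0
        obtain ⟨h1, h2⟩ := hb σ h0
        refine h1 (hycard _ fun h3 => h ?_)
        rw [← h3, Finset.card_erase_add_one h2]
      simp [e, monomialChain, this]) (by
      rw [koszul_comp, he]
      ext1 σ
      exact (Submodule.Quotient.mk_eq_zero _).2 (hmonI σ))
  choose s hs using I.mkQ_surjective
  let q : Finset (Fin n) → MvPolynomial (Fin n) k :=
    e - koszul (X : Fin n → MvPolynomial (Fin n) k) fun σ => s (g σ)
  have hq : ∀ σ, q σ ∈ I := by
    intro σ
    rw [← Submodule.Quotient.mk_eq_zero, ← Submodule.mkQ_apply]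
    have := koszul_comp (X : Fin n → MvPolynomial (Fin n) k) I.mkQ (fun σ => s (g σ))
    simp only [hs, hg] at this
    simp only [q, Pi.sub_apply, map_sub]
    rw [← congrFun this σ, sub_self]
  have hkq : koszul (X : Fin n → MvPolynomial (Fin n) k) q = monomialChain u y := by
    rw [map_sub, koszul_koszul, sub_zero, he]
  have h1 : coeff (m i) (koszul (X : Fin n → MvPolynomial (Fin n) k) q (A i)) = 1 := by
    rw [hkq]; simp [monomialChain, hu, hyA]
  refine one_ne_zero (α := k) (h1.symm.trans ?_)
  rw [koszul_apply, coeff_sum]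
  refine Finset.sum_eq_zero fun x _ => ?_
  refine (map_zsmul (lcoeff k (m i)) _ _).trans ?_
  rw [lcoeff_apply, smul_eq_mul, coeff_X_mul']
  split_ifs with hx
  · have : coeff (m i - Finsupp.single x 1) (q (insert x (A i))) = 0 := by
      by_contra h
      obtain ⟨l, hl⟩ := (hmem _).1 (hq (insert x (A i))) _ (mem_support_iff.2 h)
      by_cases hli : l = i
      · subst hli
        have := hl x
        rw [Finsupp.mem_support_iff] at hx
        simp at this
        omega
      · exact hmin l i hli (hl.trans tsub_le_self)
    rw [this, smul_zero]
  · simp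

end LowerBound

/-! ### Projective dimension through short exact sequences and resolutions -/

section Quotients

universe u

variable {R : Type u} [CommRing R]

lemma hasProjectiveDimensionLT_quotient_sup_span (J : Ideal R) (f : R) (N : ℕ)
    (h1 : HasProjectiveDimensionLT (ModuleCat.of R (R ⧸ J.colon {f})) N)
    (h2 : HasProjectiveDimensionLT (ModuleCat.of R (R ⧸ J)) (N + 1)) :
    HasProjectiveDimensionLT (ModuleCat.of R (R ⧸ (J ⊔ Ideal.span {f}))) (N + 1) := by
  let φ : (R ⧸ J.colon {f}) →ₗ[R] R ⧸ J :=
    Submodule.mapQ _ J (LinearMap.mulLeft R f) fun x hx => by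
      simpa [Submodule.mem_colon_singleton, mul_comm] using hx
  let ψ : (R ⧸ J) →ₗ[R] R ⧸ (J ⊔ Ideal.span {f}) := Submodule.factor le_sup_left
  have hφ : Function.Injective φ := by
    rw [← LinearMap.ker_eq_bot, LinearMap.ker_eq_bot']
    intro x hx
    obtain ⟨x, rfl⟩ := Submodule.mkQ_surjective _ x
    rw [Submodule.mkQ_apply, Submodule.mapQ_apply, Submodule.Quotient.mk_eq_zero] at hx
    rw [Submodule.mkQ_apply, Submodule.Quotient.mk_eq_zero, Submodule.mem_colon_singleton]
    simpa [mul_comm] using hx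
  have hψ : Function.Surjective ψ := Submodule.factor_surjective _
  have hex : Function.Exact φ ψ := by
    intro y
    obtain ⟨y, rfl⟩ := Submodule.mkQ_surjective _ y
    have : ψ (J.mkQ y) = Submodule.Quotient.mk y := rfl
    rw [this, Submodule.Quotient.mk_eq_zero, Submodule.mem_sup]
    constructor
    · rintro ⟨j, hj, z, hz, rfl⟩
      obtain ⟨x, rfl⟩ := Ideal.mem_span_singleton'.1 hz
      refine ⟨Submodule.Quotient.mk x, ?_⟩
      rw [Submodule.mapQ_apply, Submodule.mkQ_apply, Submodule.Quotient.eq]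
      simpa [mul_comm f x] using hj
    · rintro ⟨x, hx⟩
      obtain ⟨x, rfl⟩ := Submodule.mkQ_surjective _ x
      rw [Submodule.mkQ_apply, Submodule.mapQ_apply, Submodule.mkQ_apply,
        Submodule.Quotient.eq] at hx
      refine ⟨y - x * f, ?_, x * f, Ideal.mem_span_singleton'.2 ⟨x, rfl⟩, by ring⟩
      have := J.neg_mem hx
      simpa [mul_comm f x] using this
  let S : ShortComplex (ModuleCat.{u} R) :=
    ShortComplex.mk (ModuleCat.ofHom φ) (ModuleCat.ofHom ψ) (by
      ext1; exact hex.linearMap_comp_eq_zero)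
  have hS : S.ShortExact :=
    { exact := (ShortComplex.ShortExact.moduleCat_exact_iff_function_exact S).2 hex
      mono_f := (ModuleCat.mono_iff_injective _).2 hφ
      epi_g := (ModuleCat.epi_iff_surjective _).2 hψ }
  exact hS.hasProjectiveDimensionLT_X₃ N h1 h2

lemma hasProjectiveDimensionLT_quotient_span_X {n : ℕ} {k : Type u} [Field k]
    (B : Finset (Fin n)) :
    HasProjectiveDimensionLT (ModuleCat.of (MvPolynomial (Fin n) k)
      (MvPolynomial (Fin n) k ⧸ Ideal.span ((X : Fin n → MvPolynomial (Fin n) k) '' B)))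
      (B.card + 1) := by
  induction B using Finset.induction with
  | empty =>
    have : Ideal.span ((X : Fin n → MvPolynomial (Fin n) k) '' (∅ : Finset (Fin n))) = ⊥ := by simp
    rw [this]
    have := Module.Projective.of_equiv
      (Submodule.quotEquivOfEqBot (⊥ : Ideal (MvPolynomial (Fin n) k)) rfl).symm
    rw [Finset.card_empty, zero_add, ← projective_iff_hasProjectiveDimensionLT_one]
    exact (IsProjective.iff_projective _).1 this
  | insert b B hb ih =>
    have hspan : Ideal.span ((X : Fin n → MvPolynomial (Fin n) k) '' (insert b B : Finset (Fin n)))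
        = Ideal.span (X '' (B : Set (Fin n))) ⊔ Ideal.span {X b} := by
      rw [Finset.coe_insert, Set.image_insert_eq, Ideal.span_insert, sup_comm]
    have hcolon : (Ideal.span ((X : Fin n → MvPolynomial (Fin n) k) '' B)).colon {X b}
        = Ideal.span (X '' (B : Set (Fin n))) := by
      ext p
      rw [Submodule.mem_colon_singleton, smul_eq_mul]
      refine ⟨fun h => ?_, fun h => Ideal.mul_mem_right _ _ h⟩
      rw [mem_ideal_span_X_image] at h ⊢
      intro α hα
      obtain ⟨i, hi, hne⟩ := h (α + Finsupp.single b 1) (by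
        rw [mem_support_iff, coeff_mul_X]; exact mem_support_iff.1 hα)
      have hib : b ≠ i := fun h => hb (h ▸ hi)
      exact ⟨i, hi, by simpa [hib] using hne⟩
    rw [hspan, Finset.card_insert_of_notMem hb]
    refine hasProjectiveDimensionLT_quotient_sup_span _ _ _ ?_ ?_
    · rw [hcolon]; exact ih
    · exact hasProjectiveDimensionLT_of_ge _ (B.card + 1) _ (by omega)

end Quotients

section Resolutions

universe v u

variable {C : Type u} [Category.{v} C] [Abelian C]

lemma hasProjectiveDimensionLT_of_projectiveResolution {M : C} (P : ProjectiveResolution M)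
    (N : ℕ) (h : ∀ p, N ≤ p → Limits.IsZero (P.complex.X p)) : HasProjectiveDimensionLT M N := by
  let := HasExt.standard C
  rw [hasProjectiveDimensionLT_iff]
  intro i hi Y e
  obtain ⟨f, hf, rfl⟩ := P.extMk_surjective e (i + 1) rfl
  obtain rfl : f = 0 := (h i hi).eq_of_src _ _
  simp

lemma quasiIso_toSingle₀Equiv_symm (K : ChainComplex C ℕ) {M : C} (g : K.X 0 ⟶ M)
    (w : K.d 1 0 ≫ g = 0) (h0 : (ShortComplex.mk (K.d 1 0) g w).Exact) (hg : Epi g)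
    (hK : ∀ p, K.ExactAt (p + 1)) :
    QuasiIso ((ChainComplex.toSingle₀Equiv K M).symm ⟨g, w⟩) where
  quasiIsoAt p := by
    cases p with
    | zero =>
      rw [ChainComplex.quasiIsoAt₀_iff, ShortComplex.quasiIso_iff_of_zeros']
      · refine (ShortComplex.exact_and_epi_g_iff_of_iso ?_).2 ⟨h0, hg⟩
        exact ShortComplex.isoMk (Iso.refl _) (Iso.refl _) (Iso.refl _)
          ((Category.id_comp _).trans (Category.comp_id _).symm)
          ((Category.id_comp _).trans
            (ChainComplex.toSingle₀Equiv_symm_apply_f_zero g w |>.symm.trans (Category.comp_id _).symm))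
      · exact K.shape _ _ (by simp)
      · rfl
      · rfl
    | succ p =>
      rw [quasiIsoAt_iff_exactAt']
      · exact hK p
      · exact ChainComplex.exactAt_succ_single_obj _ _

/-- A projective resolution of the last term of a short exact sequence with projective middle
term, obtained by splicing a projective resolution of the first term. -/
lemma exists_projectiveResolution_of_shortExact {S : ShortComplex C} (hS : S.ShortExact)
    (h2 : Projective S.X₂) (P : ProjectiveResolution S.X₁) :
    ∃ Q : ProjectiveResolution S.X₃, Q.complex.X 0 = S.X₂ ∧
      ∀ p, Q.complex.X (p + 1) = P.complex.X p := by
  have hm : Mono S.f := hS.mono_f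
  let π₀ : P.complex.X 0 ⟶ S.X₁ := P.π.f 0
  have hπ₀ : P.complex.d 1 0 ≫ π₀ = 0 := P.complex_d_comp_π_f_zero
  have hex : (ShortComplex.mk _ _ hπ₀).Exact := P.exact₀
  have hepi : Epi π₀ := inferInstanceAs (Epi (P.π.f 0))
  have w : P.complex.d 1 0 ≫ (π₀ ≫ S.f) = 0 := by
    rw [← Category.assoc, hπ₀, Limits.zero_comp]
  let K := ChainComplex.augment P.complex (π₀ ≫ S.f) w
  have w' : K.d 1 0 ≫ (show K.X 0 ⟶ S.X₃ from S.g) = 0 := by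
    change (π₀ ≫ S.f) ≫ S.g = 0
    rw [Category.assoc, S.zero, Limits.comp_zero]
  have hproj : ∀ p, Projective (K.X p) := by
    rintro (_ | p)
    · exact h2
    · exact P.projective p
  have h0 : (ShortComplex.mk (K.d 1 0) (show K.X 0 ⟶ S.X₃ from S.g) w').Exact := by
    let φ : ShortComplex.mk (K.d 1 0) (show K.X 0 ⟶ S.X₃ from S.g) w' ⟶ S :=
      { τ₁ := π₀, τ₂ := 𝟙 _, τ₃ := 𝟙 _
        comm₁₂ := (Category.comp_id _).symm
        comm₂₃ := (Category.id_comp _).trans (Category.comp_id _).symm }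
    have : Epi φ.τ₁ := hepi
    have : IsIso φ.τ₂ := inferInstanceAs (IsIso (𝟙 _))
    have : Mono φ.τ₃ := inferInstanceAs (Mono (𝟙 _))
    exact (ShortComplex.exact_iff_of_epi_of_isIso_of_mono φ).2 hS.exact
  have hK : ∀ p, K.ExactAt (p + 1) := by
    rintro (_ | p)
    · rw [HomologicalComplex.exactAt_iff' _ 2 1 0 (by simp) (by simp)]
      let φ : ShortComplex.mk _ _ hπ₀ ⟶ K.sc' 2 1 0 :=
        { τ₁ := 𝟙 _, τ₂ := 𝟙 _, τ₃ := S.f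
          comm₁₂ := (Category.id_comp _).trans (Category.comp_id _).symm
          comm₂₃ := Category.id_comp _ }
      have : Epi φ.τ₁ := inferInstanceAs (Epi (𝟙 _))
      have : IsIso φ.τ₂ := inferInstanceAs (IsIso (𝟙 _))
      have : Mono φ.τ₃ := hm
      exact (ShortComplex.exact_iff_of_epi_of_isIso_of_mono φ).1 hex
    · rw [HomologicalComplex.exactAt_iff' _ (p + 3) (p + 2) (p + 1) (by simp) (by simp)]
      exact P.exact_succ p
  exact ⟨{ complex := K
           projective := hproj
           π := (ChainComplex.toSingle₀Equiv K S.X₃).symm ⟨S.g, w'⟩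
           quasiIso := quasiIso_toSingle₀Equiv_symm K _ w' h0 hS.epi_g hK }, rfl, fun _ => rfl⟩
lemma exists_projectiveResolution_of_hasProjectiveDimensionLT [EnoughProjectives C] (N : ℕ)
    (M : C) (hM : HasProjectiveDimensionLT M (N + 1)) :
    ∃ P : ProjectiveResolution M, ∀ p, N < p → Limits.IsZero (P.complex.X p) := by
  induction N generalizing M with
  | zero =>
    have : Projective M := projective_iff_hasProjectiveDimensionLT_one.2 hM
    refine ⟨ProjectiveResolution.self M, fun p hp => ?_⟩
    exact HomologicalComplex.isZero_single_obj_X _ _ _ _ hp.ne'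
  | succ N ih =>
    let S : ShortComplex C := ShortComplex.mk (Limits.kernel.ι (Projective.π M)) (Projective.π M)
      (Limits.kernel.condition _)
    have hS : S.ShortExact :=
      { exact := ShortComplex.exact_of_f_is_kernel _ (Limits.kernelIsKernel _)
        mono_f := inferInstanceAs (Mono (Limits.kernel.ι _))
        epi_g := inferInstanceAs (Epi (Projective.π M)) }
    obtain ⟨P, hP⟩ := ih S.X₁ ((hS.hasProjectiveDimensionLT_X₃_iff N
      (inferInstanceAs (Projective (Projective.over M)))).1 hM)
    obtain ⟨Q, -, hQ⟩ := exists_projectiveResolution_of_shortExact hS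
      (inferInstanceAs (Projective (Projective.over M))) P
    refine ⟨Q, fun p hp => ?_⟩
    obtain ⟨p, rfl⟩ : ∃ q, p = q + 1 := ⟨p - 1, by omega⟩
    rw [hQ]
    exact hP p (by omega)

end Resolutions

section LinearQuotients

variable {n t : ℕ} {k : Type} [Field k] {m : Fin t → (Fin n →₀ ℕ)} {A : Fin t → Finset (Fin n)}

lemma mul_monomial_mem_span_monomial_iff (i : Fin t) (p : MvPolynomial (Fin n) k) :
    p * monomial (m i) 1 ∈ Ideal.span ((fun j => monomial (m j) (1 : k)) '' {j | j < i}) ↔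
      ∀ α ∈ p.support, ∃ l < i, m l ≤ α + m i := by
  have h : (fun j => (monomial (m j) (1 : k) : MvPolynomial (Fin n) k)) '' {j | j < i}
      = (fun s => (monomial s (1 : k) : MvPolynomial (Fin n) k)) '' (m '' {j | j < i}) := by
    rw [Set.image_image]
  rw [h, mem_ideal_span_monomial_image]
  constructor
  · intro h α hα
    obtain ⟨_, ⟨l, hl, rfl⟩, hle⟩ := h (α + m i) (by
      rw [mem_support_iff, coeff_mul_monomial, mul_one]; exact mem_support_iff.1 hα)
    exact ⟨l, hl, hle⟩
  · intro h β hβ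
    rw [mem_support_iff, coeff_mul_monomial', mul_one] at hβ
    split_ifs at hβ with hle
    · obtain ⟨l, hl, hl'⟩ := h _ (mem_support_iff.2 hβ)
      rw [tsub_add_cancel_of_le hle] at hl'
      exact ⟨_, ⟨l, hl, rfl⟩, hl'⟩
    · exact absurd rfl hβ

lemma mem_colon_span_monomial_iff (i : Fin t) (p : MvPolynomial (Fin n) k) :
    p ∈ (Ideal.span ((fun j => monomial (m j) (1 : k)) '' {j | j < i})).colon
        {monomial (m i) (1 : k)} ↔
      ∀ α ∈ p.support, ∃ l < i, m l ≤ α + m i := by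
  rw [Submodule.mem_colon_singleton, smul_eq_mul, mul_monomial_mem_span_monomial_iff]

/-- A family of monomials has linear quotients as soon as its successive colon ideals are
generated by variables. -/
lemma hasLinearQuotients_of_colon_eq
    (hA : ∀ i, (Ideal.span ((fun j => monomial (m j) (1 : k)) '' {j | j < i})).colon
        {monomial (m i) (1 : k)} = Ideal.span ((X : Fin n → MvPolynomial (Fin n) k) '' A i)) :
    HasLinearQuotients m A where
  exists_le r a ha := by
    have h : (X a : MvPolynomial (Fin n) k) ∈ Ideal.span (X '' (A r : Set (Fin n))) :=
      Ideal.subset_span ⟨a, ha, rfl⟩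
    rw [← hA, mem_colon_span_monomial_iff] at h
    obtain ⟨l, hl, hle⟩ := h (Finsupp.single a 1) (by simp [X])
    exact ⟨l, hl, by rwa [add_comm]⟩
  exists_lt r l hl := by
    have h : (monomial (m l - m r) (1 : k) : MvPolynomial (Fin n) k) ∈
        Ideal.span (X '' (A r : Set (Fin n))) := by
      rw [← hA, mem_colon_span_monomial_iff]
      intro α hα
      obtain rfl := Finset.mem_singleton.1 (support_monomial_subset hα)
      exact ⟨l, hl, le_tsub_add⟩
    rw [mem_ideal_span_X_image] at h
    obtain ⟨a, ha, hne⟩ := h (m l - m r) (by simp)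
    refine ⟨a, ha, ?_⟩
    rw [Finsupp.tsub_apply] at hne
    omega

lemma hasProjectiveDimensionLT_quotient_span_monomial {D : ℕ} (hD : ∀ i, (A i).card ≤ D)
    (hA : ∀ i, (Ideal.span ((fun j => monomial (m j) (1 : k)) '' {j | j < i})).colon
        {monomial (m i) (1 : k)} = Ideal.span ((X : Fin n → MvPolynomial (Fin n) k) '' A i)) :
    HasProjectiveDimensionLT (ModuleCat.of (MvPolynomial (Fin n) k)
      (MvPolynomial (Fin n) k ⧸ Ideal.span (Set.range fun i => monomial (m i) (1 : k)))) (D + 2) := by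
  suffices h : ∀ r ≤ t, HasProjectiveDimensionLT (ModuleCat.of (MvPolynomial (Fin n) k)
      (MvPolynomial (Fin n) k ⧸
        Ideal.span ((fun i => monomial (m i) (1 : k)) '' {i | i.val < r}))) (D + 2) by
    have huniv : {i : Fin t | i.val < t} = Set.univ := by ext i; simp
    rw [← Set.image_univ, ← huniv]
    exact h t le_rfl
  intro r hr
  induction r with
  | zero =>
    have h0 := hasProjectiveDimensionLT_quotient_span_X (k := k) (∅ : Finset (Fin n))
    rw [Finset.coe_empty, Set.image_empty, Finset.card_empty] at h0
    have hempty : {i : Fin t | i.val < 0} = ∅ := by ext i; simp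
    rw [hempty, Set.image_empty]
    exact hasProjectiveDimensionLT_of_ge _ (0 + 1) _ (by omega)
  | succ r ih =>
    let i : Fin t := ⟨r, hr⟩
    have hset : {j : Fin t | j.val < r + 1} = insert i {j | j < i} := by
      ext j
      simp only [Set.mem_ofPred_eq, Set.mem_insert_iff, Fin.ext_iff, Fin.lt_def, i]
      omega
    rw [hset, Set.image_insert_eq, Ideal.span_insert, sup_comm]
    refine hasProjectiveDimensionLT_quotient_sup_span _ _ _ ?_ (ih (Nat.le_of_succ_le hr))
    rw [hA i]
    have := hasProjectiveDimensionLT_quotient_span_X (k := k) (A i)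
    exact hasProjectiveDimensionLT_of_ge _ ((A i).card + 1) _ (Nat.succ_le_succ (hD i))

lemma HasLinearQuotients.card_lt_of_projectiveResolution (hA : HasLinearQuotients m A)
    (hmin : ∀ i j : Fin t, i ≠ j → ¬ m i ≤ m j) (hm : ∀ i, m i ≠ 0) {N : ℕ}
    (P : ProjectiveResolution (ModuleCat.of (MvPolynomial (Fin n) k)
      (MvPolynomial (Fin n) k ⧸ Ideal.span (Set.range fun i => monomial (m i) (1 : k)))))
    (hP : ∀ p, N < p → Limits.IsZero (P.complex.X p)) (i : Fin t) : (A i).card < N := by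
  by_contra hlt
  exact hA.not_koszulAcyclic hmin i (hm i) <|
    koszulAcyclic_of_hasProjectiveDimensionLT
      (fun _ hj => koszulAcyclic_mvPolynomial n k hj) N _
      (hasProjectiveDimensionLT_of_projectiveResolution P (N + 1) fun p hp => hP p hp)
      (Nat.lt_succ_of_le (not_lt.1 hlt))

lemma colon_span_singleton {R : Type*} [CommRing R] (J : Ideal R) (f : R) :
    J.colon (Ideal.span {f} : Ideal R) = J.colon {f} := by
  ext x
  rw [Submodule.mem_colon_singleton, Submodule.mem_colon]
  refine ⟨fun h => h f (Ideal.subset_span rfl), fun h y hy => ?_⟩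
  obtain ⟨z, rfl⟩ := Ideal.mem_span_singleton'.1 hy
  rw [smul_eq_mul, mul_left_comm]
  exact J.mul_mem_left z h

end LinearQuotients

/-- Let `I ⊆ S = k[x_1,…,x_n]` be a nonzero proper monomial ideal with
linear quotients with respect to the ordering `m_1, …, m_t` of its minimal monomial
generators, with critical-index sets `A_i = { j : x_j ∈ (m_1,…,m_{i−1}) : m_i }`.
Then the projective dimension of `S/I` equals `1 + max_i |A_i|`. -/
theorem stmt_6 (k : Type) [Field k] (n t : ℕ) (ht : 0 < t)
    (m : Fin t → (Fin n →₀ ℕ))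
    (hproper : ∀ i, m i ≠ 0)
    (hmin : ∀ i j : Fin t, i ≠ j → ¬ m i ≤ m j)
    (hLQ : ∀ i : Fin t, ∃ V : Set (Fin n),
      Submodule.colon
        (Ideal.span ((fun j => monomial (m j) (1 : k)) '' {j | j < i}))
        (Ideal.span {monomial (m i) (1 : k)})
      = Ideal.span ((fun g => (X g : MvPolynomial (Fin n) k)) '' V)) :
    projectiveDimension (MvPolynomial (Fin n) k)
        (MvPolynomial (Fin n) k ⧸ Ideal.span (Set.range fun i => monomial (m i) (1 : k)))
      = ((1 + Finset.univ.sup (fun i : Fin t =>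
          Set.ncard {j : Fin n |
            (X j : MvPolynomial (Fin n) k) ∈
              Submodule.colon
                (Ideal.span ((fun l => monomial (m l) (1 : k)) '' {l | l < i}))
                (Ideal.span {monomial (m i) (1 : k)})}) : ℕ) : ℕ∞) := by
  classical
  let A : Fin t → Finset (Fin n) := fun i => {j : Fin n | (X j : MvPolynomial (Fin n) k) ∈
    Submodule.colon (Ideal.span ((fun l => monomial (m l) (1 : k)) '' {l | l < i}))
      (Ideal.span {monomial (m i) (1 : k)})}.toFinset
  have hA : ∀ i, (Ideal.span ((fun j => monomial (m j) (1 : k)) '' {j | j < i})).colon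
      {monomial (m i) (1 : k)} = Ideal.span ((X : Fin n → MvPolynomial (Fin n) k) '' A i) := by
    intro i
    obtain ⟨V, hV⟩ := hLQ i
    rw [← colon_span_singleton]
    refine le_antisymm (hV.le.trans (Ideal.span_mono (Set.image_mono fun v hv => ?_))) ?_
    · simp only [A, Set.coe_toFinset, Set.mem_ofPred_eq]
      rw [hV]
      exact Ideal.subset_span ⟨v, hv, rfl⟩
    · rw [Ideal.span_le]
      rintro _ ⟨a, ha, rfl⟩
      simpa only [A, Set.coe_toFinset, Set.mem_ofPred_eq, SetLike.mem_coe] using ha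
  simp only [Set.ncard_eq_toFinset_card']
  change _ = ((1 + Finset.univ.sup (fun i => (A i).card) : ℕ) : ℕ∞)
  have hLQ' := hasLinearQuotients_of_colon_eq hA
  refine le_antisymm (sInf_le ?_) (le_sInf ?_)
  · have hD : ∀ i, (A i).card ≤ Finset.univ.sup fun i => (A i).card := fun i =>
      Finset.le_sup (f := fun i => (A i).card) (Finset.mem_univ i)
    obtain ⟨P, hP⟩ := exists_projectiveResolution_of_hasProjectiveDimensionLT _ _
      (hasProjectiveDimensionLT_quotient_span_monomial hD hA)
    exact ⟨P, fun p hp => hP p (by rw [add_comm]; exact_mod_cast hp)⟩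
  · rintro d ⟨P, hP⟩
    induction d using ENat.recTopCoe with
    | top => exact le_top
    | coe N =>
      have h := hLQ'.card_lt_of_projectiveResolution hmin hproper P
        fun p hp => hP p (by exact_mod_cast hp)
      have hN : 0 < N := (Nat.zero_le _).trans_lt (h ⟨0, ht⟩)
      have hsup : (Finset.univ.sup fun i => (A i).card) < N :=
        (Finset.sup_lt_iff hN).2 fun i _ => h i
      exact_mod_cast (by omega : 1 + (Finset.univ.sup fun i => (A i).card) ≤ N)
end

section
/- Let I ⊆ S be a crit-monotone monomial ideal with linear quotients with respect to m_1, ..., m_t, with critical-index sets A_i, and let G̃ be the associated Eliahou–Kervaire-type complex. Then there exist k-linear maps c_p : G̃_p → G̃_{p+1} for p ≥ 0 such that: (i) for every monomial w ∈ I, c_0(w) = (w/m_i)·e_∅ g_i where i is the least index with m_i dividing w, and c_0(w) = 0 for monomials w ∉ I; (ii) d_{p+1} ∘ c_p + c_{p−1} ∘ d_p = id on G̃_p for all p ≥ 1, and d_1 ∘ c_0 = id − η on G̃_0 = S, where η : S → S is the k-linear projection fixing all monomials not in I and annihilating all monomials in I; (iii) c_{p+1} ∘ c_p = 0 for all p ≥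 0; (iv) for p ≥ 1, the image of c_p is spanned over k by those elements x^α·e_J g_i (with J ⊆ A_i, |J| = p) satisfying min( (supp(x^α) ∪ J) ∩ A_i ) ∈ J. -/
open MvPolynomial
open scoped Classical

/-- The colon ideal `(m_1,…,m_{i−1}) : m_i` of a list of monomials given by exponent
vectors `m : Fin t → (Fin n →₀ ℕ)`. -/
noncomputable def colonIdeal (k : Type) [Field k] (n t : ℕ) (m : Fin t → (Fin n →₀ ℕ))
    (i : Fin t) : Ideal (MvPolynomial (Fin n) k) :=
  Submodule.colon (Ideal.span ((fun j => monomial (m j) (1 : k)) '' {j | j < i}))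
    (Ideal.span {monomial (m i) (1 : k)})

/-- The critical-index set `A_i = { j : x_j ∈ (m_1,…,m_{i−1}) : m_i }`. -/
def critSet (k : Type) [Field k] (n t : ℕ) (m : Fin t → (Fin n →₀ ℕ)) (i : Fin t) :
    Set (Fin n) :=
  {j | (X j : MvPolynomial (Fin n) k) ∈ colonIdeal k n t m i}

/-- Index set for the basis `e_J g_i` (with `J ⊆ A_i`, `|J| = p`) of the `(p+1)`-st module
of the Eliahou–Kervaire-type complex `G̃`. -/
def EKIndex (k : Type) [Field k] (n t : ℕ) (m : Fin t → (Fin n →₀ ℕ)) (p : ℕ) : Type :=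
  {q : Fin t × Finset (Fin n) // ↑q.2 ⊆ critSet k n t m q.1 ∧ q.2.card = p}

/-- The modules of the Eliahou–Kervaire-type complex `G̃`: `G̃_0 = S` and, for `p ≥ 1`,
`G̃_p` is the free `S`-module on the symbols `e_J g_i` with `J ⊆ A_i`, `|J| = p − 1`. -/
noncomputable def EKMod (k : Type) [Field k] (n t : ℕ) (m : Fin t → (Fin n →₀ ℕ)) :
    ℕ → Type
  | 0 => MvPolynomial (Fin n) k
  | (p + 1) => EKIndex k n t m p →₀ MvPolynomial (Fin n) k

noncomputable instance (k : Type) [Field k] (n t : ℕ) (m : Fin t → (Fin n →₀ ℕ)) (p : ℕ) :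
    AddCommGroup (EKMod k n t m p) := by
  cases p with
  | zero => exact inferInstanceAs (AddCommGroup (MvPolynomial (Fin n) k))
  | succ p =>
      exact inferInstanceAs (AddCommGroup (EKIndex k n t m p →₀ MvPolynomial (Fin n) k))

noncomputable instance (k : Type) [Field k] (n t : ℕ) (m : Fin t → (Fin n →₀ ℕ)) (p : ℕ) :
    Module (MvPolynomial (Fin n) k) (EKMod k n t m p) := by
  cases p with
  | zero => exact inferInstanceAs (Module (MvPolynomial (Fin n) k) (MvPolynomial (Fin n) k))
  | succ p =>
      exact inferInstanceAs
        (Module (MvPolynomial (Fin n) k) (EKIndex k n t m p →₀ MvPolynomial (Fin n) k))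

noncomputable instance (k : Type) [Field k] (n t : ℕ) (m : Fin t → (Fin n →₀ ℕ)) (p : ℕ) :
    Module k (EKMod k n t m p) := by
  cases p with
  | zero => exact inferInstanceAs (Module k (MvPolynomial (Fin n) k))
  | succ p =>
      exact inferInstanceAs (Module k (EKIndex k n t m p →₀ MvPolynomial (Fin n) k))

/-- The basis element `e_J g_i` of `G̃_{p+1}`. -/
noncomputable def ekGen (k : Type) [Field k] (n t : ℕ) (m : Fin t → (Fin n →₀ ℕ)) {p : ℕ}
    (i : Fin t) (J : Finset (Fin n)) (h1 : ↑J ⊆ critSet k n t m i) (h2 : J.card = p) :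
    EKMod k n t m (p + 1) :=
  Finsupp.single ⟨(i, J), h1, h2⟩ 1

section Perturbation

variable {R M M' M'' : Type*} [CommRing R] [AddCommGroup M] [Module R M]
  [AddCommGroup M'] [Module R M'] [AddCommGroup M''] [Module R M'']

/-- If `h` inverts `P ∘ D` up to a nilpotent error, it can be corrected to an exact inverse
with the same range. -/
lemma exists_perturbed_inverse (D : M' →ₗ[R] M) (h : M →ₗ[R] M') (P : M →ₗ[R] M)
    (hPP : ∀ x, P (P x) = P x) (hhP : ∀ x, h (P x) = h x)
    (hnil : IsNilpotent (P - P ∘ₗ D ∘ₗ h : Module.End R M)) :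
    ∃ c : M →ₗ[R] M', (∀ x, c (P x) = c x) ∧ (∀ x, P (D (c x)) = P x) ∧
      (∀ x, c (P (D (h x))) = h x) ∧ LinearMap.range c = LinearMap.range h := by
  set ν : Module.End R M := P - P ∘ₗ D ∘ₗ h with hν
  obtain ⟨w, hw⟩ := hnil.isUnit_one_sub
  set G : Module.End R M := ↑w⁻¹ with hG
  have h1 : ∀ x, G (x - ν x) = x := fun x => by
    have : G * (1 - ν) = 1 := by rw [← hw, hG, Units.inv_mul]
    simpa using LinearMap.congr_fun this x
  have h2 : ∀ x, G x - ν (G x) = x := fun x => by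
    have : (1 - ν) * G = 1 := by rw [← hw, hG, Units.mul_inv]
    simpa using LinearMap.congr_fun this x
  have hνx : ∀ x, ν x = P x - P (D (h x)) := fun x => by simp [hν]
  have hνP : ∀ x, ν (P x) = ν x := fun x => by simp [hνx, hPP, hhP]
  have hPν : ∀ x, P (ν x) = ν x := fun x => by simp [hνx, hPP]
  have hGP : ∀ x, G (P x) = P (G x) := fun x => by
    have : P (G x) - ν (P (G x)) = P x := by
      conv_rhs => rw [← h2 x, map_sub, hPν]
      rw [hνP]
    rw [← this, h1]
  refine ⟨h ∘ₗ G, fun x => ?_, fun x => ?_, fun x => ?_, ?_⟩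
  · simp [hGP, hhP]
  · have : P (D (h (G x))) = P (G x) - ν (G x) := by rw [hνx]; abel
    rw [LinearMap.comp_apply, this, ← hPν, ← map_sub, h2]
  · have : P (D (h x)) = P x - ν (P x) := by rw [hνP, hνx]; abel
    rw [this, LinearMap.comp_apply, h1, hhP]
  · rw [LinearMap.range_comp, LinearMap.range_eq_top.2 fun x => ⟨_, h1 x⟩, Submodule.map_top]

lemma homotopy_identity (D₀ : M' →ₗ[R] M) (D₁ : M'' →ₗ[R] M') (hDD : ∀ x, D₀ (D₁ x) = 0)
    (h₀ : M →ₗ[R] M') (P₀ : M →ₗ[R] M) (P₁ : M' →ₗ[R] M')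
    (c₀ : M →ₗ[R] M') (c₁ : M' →ₗ[R] M'')
    (hker : ∀ y, y - P₁ y ∈ LinearMap.range h₀)
    (hc₀ : ∀ x, c₀ (P₀ x) = c₀ x) (hc₀' : ∀ x, c₀ (P₀ (D₀ (h₀ x))) = h₀ x)
    (hc₁ : ∀ x, P₁ (D₁ (c₁ x)) = P₁ x) (y : M') :
    D₁ (c₁ y) + c₀ (D₀ y) = y := by
  have hmem : D₁ (c₁ y) - y ∈ LinearMap.range h₀ := by
    have := sub_mem (hker (D₁ (c₁ y))) (hker y)
    rw [hc₁] at this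
    convert this using 1
    abel
  obtain ⟨x, hx⟩ := hmem
  have h := hc₀' x
  rw [hx, hc₀, map_sub, map_sub, hDD, map_zero, zero_sub] at h
  rw [← neg_neg (c₀ (D₀ y)), h]
  abel

end Perturbation

section SignedSums

variable {ι M : Type*} [LinearOrder ι] [AddCommGroup M]

lemma filter_lt_erase_card {J : Finset ι} {j l : ι} (hj : j ∈ J) :
    (J.filter (· < l)).card = ((J.erase j).filter (· < l)).card + if j < l then 1 else 0 := by
  rw [Finset.filter_erase]
  split_ifs with h
  · rw [Finset.card_erase_add_one (by simp [hj, h])]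
  · rw [Finset.erase_eq_of_notMem (by simp [h]), add_zero]

lemma neg_one_pow_erase_antisymm {J : Finset ι} {j l : ι} (hj : j ∈ J) (hl : l ∈ J)
    (hne : j ≠ l) :
    (-1 : ℤ) ^ (J.filter (· < j)).card * (-1) ^ ((J.erase j).filter (· < l)).card =
      -((-1 : ℤ) ^ (J.filter (· < l)).card * (-1) ^ ((J.erase l).filter (· < j)).card) := by
  rw [filter_lt_erase_card (l := j) hl, filter_lt_erase_card (l := l) hj]
  rcases lt_or_gt_of_ne hne with h | h <;> simp [h, h.not_gt, pow_succ] <;> ring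

lemma sum_sum_erase_signed_eq_zero (J : Finset ι) (F : ι → ι → M)
    (hF : ∀ j ∈ J, ∀ l ∈ J, j ≠ l → F j l = F l j) :
    ∑ j ∈ J, (-1 : ℤ) ^ (J.filter (· < j)).card •
      ∑ l ∈ J.erase j, (-1 : ℤ) ^ ((J.erase j).filter (· < l)).card • F j l = 0 := by
  simp_rw [Finset.smul_sum, smul_smul]
  rw [Finset.sum_sigma']
  refine Finset.sum_involution (fun x _ => ⟨x.2, x.1⟩) ?_ ?_ ?_ ?_
  · rintro ⟨j, l⟩ h
    simp only [Finset.mem_sigma, Finset.mem_erase] at h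
    rw [neg_one_pow_erase_antisymm h.1 h.2.2 h.2.1.symm, hF j h.1 l h.2.2 h.2.1.symm, neg_smul]
    exact neg_add_cancel _
  · rintro ⟨j, l⟩ h _
    simp only [Finset.mem_sigma, Finset.mem_erase] at h
    simp [h.2.1]
  · rintro ⟨j, l⟩ h
    simp only [Finset.mem_sigma, Finset.mem_erase] at h ⊢
    exact ⟨h.2.2, h.2.1.symm, h.1⟩
  · rintro ⟨j, l⟩ _
    rfl

end SignedSums

section Combinatorics

variable {k : Type} [Field k] {n t : ℕ} {m : Fin t → (Fin n →₀ ℕ)}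
  {κ : Fin t → Fin n → Fin t} {u : Fin t → Fin n → (Fin n →₀ ℕ)}

lemma monomial_mem_colonIdeal_iff {i : Fin t} {β : Fin n →₀ ℕ} :
    monomial β (1 : k) ∈ colonIdeal k n t m i ↔ ∃ i' < i, m i' ≤ β + m i := by
  have h : (fun j => monomial (m j) (1 : k)) '' {j | j < i} =
      (fun s => monomial s (1 : k)) '' (m '' {j | j < i}) := by
    rw [Set.image_image]
  rw [colonIdeal, ← Ideal.submodule_span_eq, Submodule.colon_span, Submodule.mem_colon_singleton,
    smul_eq_mul, monomial_mul, mul_one, h, mem_ideal_span_monomial_image]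
  simp [support_monomial]

lemma mem_critSet_iff {i : Fin t} {j : Fin n} :
    j ∈ critSet k n t m i ↔ ∃ i' < i, m i' ≤ Finsupp.single j 1 + m i :=
  monomial_mem_colonIdeal_iff

lemma exists_mem_critSet_of_le
    (hLQ : ∀ i : Fin t, ∃ V : Set (Fin n),
      colonIdeal k n t m i = Ideal.span ((fun g => (X g : MvPolynomial (Fin n) k)) '' V))
    {i i' : Fin t} {β : Fin n →₀ ℕ} (hlt : i' < i) (hle : m i' ≤ β + m i) :
    ∃ a ∈ critSet k n t m i, a ∈ β.support := by
  obtain ⟨V, hV⟩ := hLQ i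
  have hmem : monomial β (1 : k) ∈ colonIdeal k n t m i :=
    monomial_mem_colonIdeal_iff.2 ⟨i', hlt, hle⟩
  rw [hV, mem_ideal_span_X_image] at hmem
  obtain ⟨a, haV, ha⟩ := hmem β (by simp [support_monomial])
  refine ⟨a, ?_, by simpa using ha⟩
  change X a ∈ colonIdeal k n t m i
  rw [hV]
  exact Ideal.subset_span ⟨a, haV, rfl⟩

/-- The combinatorial consequences of having linear quotients with a crit-monotone
decomposition function `κ`. -/
structure IsCritMonotone (k : Type) [Field k] (n t : ℕ) (m : Fin t → (Fin n →₀ ℕ))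
    (κ : Fin t → Fin n → Fin t) (u : Fin t → Fin n → (Fin n →₀ ℕ)) : Prop where
  exists_mem : ∀ {i i' : Fin t} {β : Fin n →₀ ℕ}, i' < i → m i' ≤ β + m i →
    ∃ a ∈ critSet k n t m i, a ∈ β.support
  eq_add : ∀ {i j}, j ∈ critSet k n t m i → Finsupp.single j 1 + m i = u i j + m (κ i j)
  notMem : ∀ {i j}, j ∈ critSet k n t m i →
    ∀ g ∈ (u i j).support, g ∉ critSet k n t m (κ i j)
  subset : ∀ {i j}, j ∈ critSet k n t m i →
    critSet k n t m (κ i j) ⊆ critSet k n t m i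

namespace IsCritMonotone

lemma eq_of_add_eq_add (H : IsCritMonotone k n t m κ u)
    {r r' : Fin t} {β β' : Fin n →₀ ℕ} (h : β + m r = β' + m r')
    (hβ : ∀ g ∈ β.support, g ∉ critSet k n t m r)
    (hβ' : ∀ g ∈ β'.support, g ∉ critSet k n t m r') : r = r' ∧ β = β' := by
  have hr : r = r' := by
    rcases lt_trichotomy r r' with hlt | rfl | hlt
    · obtain ⟨a, ha, ha'⟩ := H.exists_mem (β := β') hlt (h ▸ le_add_self)
      exact absurd ha (hβ' a ha')
    · rfl
    · obtain ⟨a, ha, ha'⟩ := H.exists_mem (β := β) hlt (h ▸ le_add_self)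
      exact absurd ha (hβ a ha')
  subst hr
  exact ⟨rfl, add_right_cancel h⟩

lemma lt (H : IsCritMonotone k n t m κ u)
    {i : Fin t} {j : Fin n} (hj : j ∈ critSet k n t m i) : κ i j < i := by
  by_contra! hle
  obtain ⟨i', hi', hm⟩ := mem_critSet_iff.1 hj
  rw [H.eq_add hj] at hm
  obtain ⟨a, ha, ha'⟩ := H.exists_mem (hi'.trans_le hle) hm
  exact H.notMem hj a ha' ha

end IsCritMonotone

/-- `a` is the least element of `(supp x^α ∪ J) ∩ A_i`, and it does not belong to `J`. -/
def IsPivot (k : Type) [Field k] {n t : ℕ} (m : Fin t → (Fin n →₀ ℕ)) (α : Fin n →₀ ℕ)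
    (i : Fin t) (J : Finset (Fin n)) (a : Fin n) : Prop :=
  a ∈ critSet k n t m i ∧ a ∈ α.support ∧ a ∉ J ∧
    ∀ b ∈ critSet k n t m i, (b ∈ α.support ∨ b ∈ J) → a ≤ b

variable {α : Fin n →₀ ℕ} {i : Fin t} {J : Finset (Fin n)} {a : Fin n}

lemma IsPivot.unique {b : Fin n} (ha : IsPivot k m α i J a) (hb : IsPivot k m α i J b) : a = b :=
  le_antisymm (ha.2.2.2 b hb.1 (Or.inl hb.2.1)) (hb.2.2.2 a ha.1 (Or.inl ha.2.1))

lemma not_isPivot_of_mem (hJ : a ∈ J) (haA : a ∈ critSet k n t m i)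
    (hmin : ∀ b ∈ critSet k n t m i, (b ∈ α.support ∨ b ∈ J) → a ≤ b) (b : Fin n) :
    ¬ IsPivot k m α i J b := by
  rintro ⟨hbA, hbα, hbJ, hb⟩
  have : a = b := le_antisymm (hmin b hbA (Or.inl hbα)) (hb a haA (Or.inr hJ))
  exact hbJ (this ▸ hJ)

lemma exists_min_mem_of_not_isPivot (hJA : (J : Set (Fin n)) ⊆ critSet k n t m i)
    (hJ : J.Nonempty) (hno : ∀ b, ¬ IsPivot k m α i J b) :
    ∃ a ∈ J, ∀ b ∈ critSet k n t m i, (b ∈ α.support ∨ b ∈ J) → a ≤ b := by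
  set T : Finset (Fin n) := {b | b ∈ critSet k n t m i ∧ (b ∈ α.support ∨ b ∈ J)} with hT
  have hTne : T.Nonempty := by
    obtain ⟨x, hx⟩ := hJ
    exact ⟨x, by simpa [hT, hx] using hJA hx⟩
  have hmem := T.min'_mem hTne
  have hmin : ∀ b ∈ critSet k n t m i, (b ∈ α.support ∨ b ∈ J) → T.min' hTne ≤ b :=
    fun b hb hb' => T.min'_le b (by simp [hT, hb, -Finsupp.mem_support_iff, hb'])
  simp only [hT, Finset.mem_filter, Finset.mem_univ, true_and] at hmem
  refine ⟨T.min' hTne, ?_, hmin⟩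
  by_contra hnot
  exact hno _ ⟨hmem.1, hmem.2.resolve_right hnot, hnot, hmin⟩

end Combinatorics

section Modules

variable (k : Type) [Field k] {n t : ℕ} (m : Fin t → (Fin n →₀ ℕ))

noncomputable instance (p : ℕ) : IsScalarTower k (MvPolynomial (Fin n) k) (EKMod k n t m p) := by
  cases p with
  | zero =>
    exact inferInstanceAs
      (IsScalarTower k (MvPolynomial (Fin n) k) (MvPolynomial (Fin n) k))
  | succ p =>
    exact inferInstanceAs
      (IsScalarTower k (MvPolynomial (Fin n) k) (EKIndex k n t m p →₀ MvPolynomial (Fin n) k))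

/-- The element `x^α • e_J g_i` of `G̃_{p+1}`, or `0` when `e_J g_i` is not one of the
basis symbols of `G̃_{p+1}`. -/
noncomputable def ekMon (p : ℕ) (α : Fin n →₀ ℕ) (i : Fin t) (J : Finset (Fin n)) :
    EKMod k n t m (p + 1) :=
  if h : ↑J ⊆ critSet k n t m i ∧ J.card = p then
    (Finsupp.single (⟨(i, J), h⟩ : EKIndex k n t m p) (monomial α (1 : k)) :
      EKIndex k n t m p →₀ MvPolynomial (Fin n) k)
  else 0

/-- The `k`-basis of `G̃_{p+1}` consisting of the elements `x^α • e_J g_i`. -/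
noncomputable def ekBasis (p : ℕ) :
    Module.Basis (Σ _ : EKIndex k n t m p, Fin n →₀ ℕ) k (EKMod k n t m (p + 1)) :=
  (Finsupp.basis fun _ => basisMonomials (Fin n) k :
    Module.Basis (Σ _ : EKIndex k n t m p, Fin n →₀ ℕ) k
      (EKIndex k n t m p →₀ MvPolynomial (Fin n) k))

variable {k m} {p : ℕ} {α β : Fin n →₀ ℕ} {i : Fin t} {J : Finset (Fin n)}

lemma ekMon_eq_single (h : ↑J ⊆ critSet k n t m i ∧ J.card = p) :
    ekMon k m p α i J =
      (Finsupp.single (⟨(i, J), h⟩ : EKIndex k n t m p) (monomial α (1 : k)) :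
        EKIndex k n t m p →₀ MvPolynomial (Fin n) k) :=
  dif_pos h

lemma ekMon_eq_zero (h : ¬ (↑J ⊆ critSet k n t m i ∧ J.card = p)) :
    ekMon k m p α i J = 0 :=
  dif_neg h

lemma single_eq_ekMon (q : EKIndex k n t m p) :
    (Finsupp.single q (monomial α (1 : k)) : EKMod k n t m (p + 1)) =
      ekMon k m p α q.1.1 q.1.2 :=
  (ekMon_eq_single q.2).symm

lemma ekMon_of_not_subset (h : ¬ (J : Set (Fin n)) ⊆ critSet k n t m i) :
    ekMon k m p α i J = 0 :=
  ekMon_eq_zero fun h' => h h'.1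

lemma ekBasis_apply (x : Σ _ : EKIndex k n t m p, Fin n →₀ ℕ) :
    ekBasis k m p x = ekMon k m p x.2 x.1.1.1 x.1.1.2 := by
  rw [← single_eq_ekMon]
  change (Finsupp.basis fun _ => basisMonomials (Fin n) k) x = _
  rw [Finsupp.coe_basis, coe_basisMonomials]

lemma monomial_smul_ekMon :
    monomial β (1 : k) • ekMon k m p α i J = ekMon k m p (β + α) i J := by
  by_cases h : ↑J ⊆ critSet k n t m i ∧ J.card = p
  · rw [ekMon_eq_single h, ekMon_eq_single h]
    refine (Finsupp.smul_single _ _ _).trans ?_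
    rw [smul_eq_mul, monomial_mul, mul_one]
  · rw [ekMon_eq_zero h, ekMon_eq_zero h, smul_zero]

lemma ekGen_eq_ekMon (h1 : ↑J ⊆ critSet k n t m i) (h2 : J.card = p) :
    ekGen k n t m i J h1 h2 = ekMon k m p 0 i J :=
  (ekMon_eq_single ⟨h1, h2⟩).symm

lemma monomial_smul_ekGen (h1 : ↑J ⊆ critSet k n t m i) (h2 : J.card = p) :
    monomial β (1 : k) • ekGen k n t m i J h1 h2 = ekMon k m p β i J := by
  rw [ekGen_eq_ekMon, monomial_smul_ekMon, add_zero]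

lemma ekMod_hom_ext {N : Type*} [AddCommGroup N] [Module k N]
    {f g : EKMod k n t m (p + 1) →ₗ[k] N}
    (h : ∀ (α : Fin n →₀ ℕ) (i : Fin t) (J : Finset (Fin n)), ↑J ⊆ critSet k n t m i →
      J.card = p → f (ekMon k m p α i J) = g (ekMon k m p α i J)) : f = g :=
  (ekBasis k m p).ext fun x => by
    rw [ekBasis_apply]
    exact h _ _ _ x.1.2.1 x.1.2.2

lemma ekMod_induction {Q : Submodule k (EKMod k n t m (p + 1))}
    (h : ∀ (α : Fin n →₀ ℕ) (i : Fin t) (J : Finset (Fin n)), ↑J ⊆ critSet k n t m i →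
      J.card = p → ekMon k m p α i J ∈ Q) (y : EKMod k n t m (p + 1)) : y ∈ Q := by
  have : ⊤ ≤ Q := by
    rw [← (ekBasis k m p).span_eq, Submodule.span_le]
    rintro _ ⟨x, rfl⟩
    rw [ekBasis_apply]
    exact h _ _ _ x.1.2.1 x.1.2.2
  exact this trivial

end Modules

section Differential

variable {k : Type} [Field k] {n t : ℕ} {m : Fin t → (Fin n →₀ ℕ)}
  {κ : Fin t → Fin n → Fin t} {u : Fin t → Fin n → (Fin n →₀ ℕ)}
  {p : ℕ} {α : Fin n →₀ ℕ} {i : Fin t} {J : Finset (Fin n)}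

/-- The monomial `x^α` as an element of `G̃_0 = S`. -/
noncomputable def ekMonZero (k : Type) [Field k] {n t : ℕ} (m : Fin t → (Fin n →₀ ℕ))
    (α : Fin n →₀ ℕ) : EKMod k n t m 0 :=
  (monomial α (1 : k) : MvPolynomial (Fin n) k)

lemma ekModZero_hom_ext {N : Type*} [AddCommGroup N] [Module k N]
    {f g : EKMod k n t m 0 →ₗ[k] N} (h : ∀ α, f (ekMonZero k m α) = g (ekMonZero k m α)) :
    f = g :=
  (basisMonomials (Fin n) k).ext (M := MvPolynomial (Fin n) k) h

/-- The differential of the Eliahou–Kervaire-type complex, on `k`-basis elements. -/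
structure IsEKDifferential (κ : Fin t → Fin n → Fin t) (u : Fin t → Fin n → (Fin n →₀ ℕ))
    (d : ∀ p : ℕ, EKMod k n t m (p + 1) →ₗ[k] EKMod k n t m p) : Prop where
  zero : ∀ α i, d 0 (ekMon k m 0 α i ∅) = ekMonZero k m (α + m i)
  succ : ∀ (p : ℕ) (α : Fin n →₀ ℕ) (i : Fin t) (J : Finset (Fin n)),
    ↑J ⊆ critSet k n t m i → J.card = p + 1 →
    d (p + 1) (ekMon k m (p + 1) α i J) =
      ∑ j ∈ J, (-1 : ℤ) ^ (J.filter (· < j)).card •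
        (ekMon k m p (α + Finsupp.single j 1) i (J.erase j) -
          ekMon k m p (α + u i j) (κ i j) (J.erase j))

namespace IsCritMonotone

lemma exists_two_step (H : IsCritMonotone k n t m κ u)
    {j l : Fin n} (hJ : (J : Set (Fin n)) ⊆ critSet k n t m i) (hj : j ∈ J)
    (hl : l ∈ J.erase j) :
    ∃ (β : Fin n →₀ ℕ) (r : Fin t),
      β + m r = Finsupp.single j 1 + Finsupp.single l 1 + m i ∧
      (∀ g ∈ β.support, g ∉ critSet k n t m r) ∧
      (if (J.erase j : Set (Fin n)) ⊆ critSet k n t m (κ i j) then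
        ekMon k m p (α + u i j + Finsupp.single l 1) (κ i j) ((J.erase j).erase l) -
          ekMon k m p (α + u i j + u (κ i j) l) (κ (κ i j) l) ((J.erase j).erase l)
        else 0) =
      ekMon k m p (α + u i j + Finsupp.single l 1) (κ i j) ((J.erase j).erase l) -
        ekMon k m p (α + β) r ((J.erase j).erase l) := by
  have hjA := hJ hj
  have hsum := H.eq_add hjA
  by_cases hlA : l ∈ critSet k n t m (κ i j)
  · refine ⟨u i j + u (κ i j) l, κ (κ i j) l, ?_, ?_, ?_⟩
    · rw [add_assoc, ← H.eq_add hlA, add_left_comm, ← hsum]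
      abel
    · intro g hg
      rcases Finset.mem_union.1 (Finsupp.support_add hg) with h | h
      · exact fun hg' => H.notMem hjA g h (H.subset hlA hg')
      · exact H.notMem hlA g h
    · split_ifs with hsub
      · rw [add_assoc α (u i j) (u (κ i j) l)]
      · have hK : ¬ (((J.erase j).erase l : Finset (Fin n)) : Set (Fin n)) ⊆
            critSet k n t m (κ i j) := by
          intro hK
          refine hsub fun x hx => ?_
          by_cases hxl : x = l
          · exact hxl ▸ hlA
          · exact hK (Finset.mem_coe.2 (Finset.mem_erase.2 ⟨hxl, hx⟩))
        rw [ekMon_of_not_subset hK, ekMon_of_not_subset fun h => hK (h.trans (H.subset hlA)),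
          sub_zero]
  · refine ⟨u i j + Finsupp.single l 1, κ i j, ?_, ?_, ?_⟩
    · rw [add_right_comm, ← hsum]
      abel
    · intro g hg
      rcases Finset.mem_union.1 (Finsupp.support_add hg) with h | h
      · exact H.notMem hjA g h
      · replace h := Finset.mem_singleton.1 (Finsupp.support_single_subset h)
        exact h ▸ hlA
    · rw [if_neg fun h => hlA (h hl), add_assoc, sub_self]

variable {d : ∀ p : ℕ, EKMod k n t m (p + 1) →ₗ[k] EKMod k n t m p}

lemma d_comp_d_zero (H : IsCritMonotone k n t m κ u) (hd : IsEKDifferential κ u d)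
    (y : EKMod k n t m 2) : d 0 (d 1 y) = 0 := by
  suffices h : d 0 ∘ₗ d 1 = 0 from LinearMap.congr_fun h y
  refine ekMod_hom_ext fun α i J hJ hcard => ?_
  obtain ⟨a, rfl⟩ := Finset.card_eq_one.1 hcard
  have ha : a ∈ critSet k n t m i := hJ (by simp)
  rw [LinearMap.comp_apply, hd.succ 0 α i _ hJ hcard, Finset.sum_singleton, Finset.erase_singleton,
    map_zsmul, map_sub, hd.zero, hd.zero, add_assoc, add_assoc, H.eq_add ha, sub_self, smul_zero,
    LinearMap.zero_apply]

lemma d_comp_d_succ (H : IsCritMonotone k n t m κ u) (hd : IsEKDifferential κ u d)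
    (y : EKMod k n t m (p + 3)) : d (p + 1) (d (p + 2) y) = 0 := by
  suffices h : d (p + 1) ∘ₗ d (p + 2) = 0 from LinearMap.congr_fun h y
  refine ekMod_hom_ext fun α i J hJ hcard => ?_
  rw [LinearMap.comp_apply, hd.succ (p + 1) α i J hJ hcard, map_sum, LinearMap.zero_apply]
  set E := ekMon k m p
  let F : Fin n → Fin n → EKMod k n t m (p + 1) := fun j l =>
    E (α + Finsupp.single j 1 + Finsupp.single l 1) i ((J.erase j).erase l) -
      E (α + Finsupp.single j 1 + u i l) (κ i l) ((J.erase j).erase l) -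
    if (J.erase j : Set (Fin n)) ⊆ critSet k n t m (κ i j) then
      E (α + u i j + Finsupp.single l 1) (κ i j) ((J.erase j).erase l) -
        E (α + u i j + u (κ i j) l) (κ (κ i j) l) ((J.erase j).erase l)
    else 0
  have key : ∀ j ∈ J, d (p + 1) ((-1 : ℤ) ^ (J.filter (· < j)).card •
        (ekMon k m (p + 1) (α + Finsupp.single j 1) i (J.erase j) -
          ekMon k m (p + 1) (α + u i j) (κ i j) (J.erase j))) =
      (-1 : ℤ) ^ (J.filter (· < j)).card •
        ∑ l ∈ J.erase j, (-1 : ℤ) ^ ((J.erase j).filter (· < l)).card • F j l := by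
    intro j hj
    have hcard' : (J.erase j).card = p + 1 := by rw [Finset.card_erase_of_mem hj, hcard]; rfl
    have hJ' : ((J.erase j : Finset (Fin n)) : Set (Fin n)) ⊆ critSet k n t m i :=
      fun x hx => hJ (Finset.erase_subset _ _ hx)
    rw [map_zsmul, map_sub, hd.succ p _ i _ hJ' hcard']
    congr 1
    by_cases hc : ((J.erase j : Finset (Fin n)) : Set (Fin n)) ⊆ critSet k n t m (κ i j)
    · rw [hd.succ p _ _ _ hc hcard', ← Finset.sum_sub_distrib]
      refine Finset.sum_congr rfl fun l _ => ?_
      simp only [F, if_pos hc, smul_sub, E]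
    · rw [ekMon_of_not_subset hc, map_zero, sub_zero]
      refine Finset.sum_congr rfl fun l _ => ?_
      simp only [F, if_neg hc, sub_zero, E]
  rw [Finset.sum_congr rfl key]
  refine sum_sum_erase_signed_eq_zero J F fun j hj l hl hne => ?_
  obtain ⟨β, r, hβ, hβd, hβE⟩ := H.exists_two_step (p := p) (α := α) hJ hj
    (Finset.mem_erase.2 ⟨hne.symm, hl⟩)
  obtain ⟨β', r', hβ', hβd', hβE'⟩ := H.exists_two_step (p := p) (α := α) hJ hl
    (Finset.mem_erase.2 ⟨hne, hj⟩)
  obtain ⟨rfl, rfl⟩ := H.eq_of_add_eq_add (hβ.trans (by rw [hβ', add_comm (Finsupp.single j 1)]))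
    hβd hβd'
  simp only [F, E]
  rw [hβE, hβE', Finset.erase_right_comm (a := l), add_right_comm α (Finsupp.single l 1),
    add_right_comm α (Finsupp.single l 1), add_right_comm α (u i l)]
  abel

lemma d_comp_d (H : IsCritMonotone k n t m κ u) (hd : IsEKDifferential κ u d)
    (y : EKMod k n t m (p + 2)) : d p (d (p + 1) y) = 0 := by
  cases p with
  | zero => exact H.d_comp_d_zero hd y
  | succ p => exact H.d_comp_d_succ hd y

end IsCritMonotone

end Differential

section Matching

variable (k : Type) [Field k] {n t : ℕ} (m : Fin t → (Fin n →₀ ℕ))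

/-- The acyclic matching on the `k`-basis of `G̃`: it moves the pivot from the coefficient
monomial to the exterior part, and annihilates the basis elements without a pivot. -/
noncomputable def matchMap (p : ℕ) : EKMod k n t m (p + 1) →ₗ[k] EKMod k n t m (p + 2) :=
  (ekBasis k m p).constr k fun x =>
    if h : ∃ a, IsPivot k m x.2 x.1.1.1 x.1.1.2 a then
      ekMon k m (p + 1) (x.2 - Finsupp.single h.choose 1) x.1.1.1 (insert h.choose x.1.1.2)
    else 0

/-- The projection of `G̃_{p+1}` onto the span of the basis elements with a pivot. -/
noncomputable def pivotProj (p : ℕ) : EKMod k n t m (p + 1) →ₗ[k] EKMod k n t m (p + 1) :=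
  (ekBasis k m p).constr k fun x =>
    if ∃ a, IsPivot k m x.2 x.1.1.1 x.1.1.2 a then ekMon k m p x.2 x.1.1.1 x.1.1.2 else 0

/-- The matching in degree zero: a monomial in the ideal is divided by the first generator
dividing it. -/
noncomputable def matchMapZero : EKMod k n t m 0 →ₗ[k] EKMod k n t m 1 :=
  ((basisMonomials (Fin n) k).constr k fun α =>
    if h : ∃ i, m i ≤ α ∧ ∀ i', m i' ≤ α → i ≤ i' then
      ekMon k m 0 (α - m h.choose) h.choose ∅
    else 0 : MvPolynomial (Fin n) k →ₗ[k] EKMod k n t m 1)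

/-- The projection of `S` onto the span of the monomials in the ideal. -/
noncomputable def pivotProjZero : EKMod k n t m 0 →ₗ[k] EKMod k n t m 0 :=
  ((basisMonomials (Fin n) k).constr k fun α =>
    if ∃ i, m i ≤ α then ekMonZero k m α else 0 : MvPolynomial (Fin n) k →ₗ[k] EKMod k n t m 0)

variable {k m} {p : ℕ} {α : Fin n →₀ ℕ} {i : Fin t} {J : Finset (Fin n)} {a : Fin n}

lemma ekMon_eq_ekBasis (h : ↑J ⊆ critSet k n t m i ∧ J.card = p) :
    ekMon k m p α i J = ekBasis k m p ⟨(⟨(i, J), h⟩ : EKIndex k n t m p), α⟩ :=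
  (ekBasis_apply ⟨(⟨(i, J), h⟩ : EKIndex k n t m p), α⟩).symm

lemma matchMap_of_isPivot (hJ : ↑J ⊆ critSet k n t m i) (hcard : J.card = p)
    (ha : IsPivot k m α i J a) :
    matchMap k m p (ekMon k m p α i J) =
      ekMon k m (p + 1) (α - Finsupp.single a 1) i (insert a J) := by
  have h : ∃ a, IsPivot k m α i J a := ⟨a, ha⟩
  rw [ekMon_eq_ekBasis ⟨hJ, hcard⟩, matchMap, Module.Basis.constr_basis, ha.unique h.choose_spec]
  exact dif_pos h

lemma matchMap_of_not_isPivot (hJ : ↑J ⊆ critSet k n t m i) (hcard : J.card = p)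
    (h : ¬ ∃ a, IsPivot k m α i J a) : matchMap k m p (ekMon k m p α i J) = 0 := by
  rw [ekMon_eq_ekBasis ⟨hJ, hcard⟩, matchMap, Module.Basis.constr_basis]
  exact dif_neg h

lemma pivotProj_of_isPivot (h : ∃ a, IsPivot k m α i J a) :
    pivotProj k m p (ekMon k m p α i J) = ekMon k m p α i J := by
  by_cases hv : ↑J ⊆ critSet k n t m i ∧ J.card = p
  · conv_lhs => rw [ekMon_eq_ekBasis hv, pivotProj, Module.Basis.constr_basis]
    exact if_pos h
  · rw [ekMon_eq_zero hv, map_zero]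

lemma pivotProj_of_not_isPivot (h : ¬ ∃ a, IsPivot k m α i J a) :
    pivotProj k m p (ekMon k m p α i J) = 0 := by
  by_cases hv : ↑J ⊆ critSet k n t m i ∧ J.card = p
  · rw [ekMon_eq_ekBasis hv, pivotProj, Module.Basis.constr_basis]
    exact if_neg h
  · rw [ekMon_eq_zero hv, map_zero]

lemma matchMapZero_of_isLeast (hi : m i ≤ α) (hmin : ∀ i', m i' ≤ α → i ≤ i') :
    matchMapZero k m (ekMonZero k m α) = ekMon k m 0 (α - m i) i ∅ := by
  have h : ∃ i, m i ≤ α ∧ ∀ i', m i' ≤ α → i ≤ i' := ⟨i, hi, hmin⟩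
  have hii : i = h.choose :=
    le_antisymm (hmin _ h.choose_spec.1) (h.choose_spec.2 _ hi)
  refine ((basisMonomials (Fin n) k).constr_basis k _ α).trans ((dif_pos h).trans ?_)
  rw [← hii]

lemma exists_isLeast (h : ∃ i, m i ≤ α) : ∃ i, m i ≤ α ∧ ∀ i', m i' ≤ α → i ≤ i' := by
  obtain ⟨i, hi, hmin⟩ := wellFounded_lt.has_min {i | m i ≤ α} h
  exact ⟨i, hi, fun i' hi' => not_lt.1 (hmin i' hi')⟩

lemma matchMapZero_of_not_le (h : ¬ ∃ i, m i ≤ α) : matchMapZero k m (ekMonZero k m α) = 0 := by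
  refine ((basisMonomials (Fin n) k).constr_basis k _ α).trans (dif_neg ?_)
  exact fun ⟨i, hi⟩ => h ⟨i, hi.1⟩

lemma pivotProjZero_of_le (h : ∃ i, m i ≤ α) :
    pivotProjZero k m (ekMonZero k m α) = ekMonZero k m α :=
  ((basisMonomials (Fin n) k).constr_basis k _ α).trans (if_pos h)

lemma pivotProjZero_of_not_le (h : ¬ ∃ i, m i ≤ α) :
    pivotProjZero k m (ekMonZero k m α) = 0 :=
  ((basisMonomials (Fin n) k).constr_basis k _ α).trans (if_neg h)

lemma pivotProj_pivotProj (y : EKMod k n t m (p + 1)) :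
    pivotProj k m p (pivotProj k m p y) = pivotProj k m p y := by
  suffices h : pivotProj k m p ∘ₗ pivotProj k m p = pivotProj k m p from LinearMap.congr_fun h y
  refine ekMod_hom_ext fun α i J _ _ => ?_
  by_cases h : ∃ a, IsPivot k m α i J a
  · rw [LinearMap.comp_apply, pivotProj_of_isPivot h, pivotProj_of_isPivot h]
  · rw [LinearMap.comp_apply, pivotProj_of_not_isPivot h, map_zero]

lemma matchMap_pivotProj (y : EKMod k n t m (p + 1)) :
    matchMap k m p (pivotProj k m p y) = matchMap k m p y := by
  suffices h : matchMap k m p ∘ₗ pivotProj k m p = matchMap k m p from LinearMap.congr_fun h y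
  refine ekMod_hom_ext fun α i J hJ hcard => ?_
  by_cases h : ∃ a, IsPivot k m α i J a
  · rw [LinearMap.comp_apply, pivotProj_of_isPivot h]
  · rw [LinearMap.comp_apply, pivotProj_of_not_isPivot h, map_zero,
      matchMap_of_not_isPivot hJ hcard h]

lemma matchMapZero_pivotProjZero (y : EKMod k n t m 0) :
    matchMapZero k m (pivotProjZero k m y) = matchMapZero k m y := by
  suffices h : matchMapZero k m ∘ₗ pivotProjZero k m = matchMapZero k m from
    LinearMap.congr_fun h y
  refine ekModZero_hom_ext fun α => ?_
  by_cases h : ∃ i, m i ≤ α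
  · rw [LinearMap.comp_apply, pivotProjZero_of_le h]
  · rw [LinearMap.comp_apply, pivotProjZero_of_not_le h, map_zero, matchMapZero_of_not_le h]

/-- A basis element without a pivot and with nonempty exterior part is a value of the matching. -/
lemma matchMap_add_single (hJ : ↑J ⊆ critSet k n t m i) (hcard : J.card = p + 1) (ha : a ∈ J)
    (hmin : ∀ b ∈ critSet k n t m i, (b ∈ α.support ∨ b ∈ J) → a ≤ b) :
    matchMap k m p (ekMon k m p (α + Finsupp.single a 1) i (J.erase a)) =
      ekMon k m (p + 1) α i J := by
  rw [matchMap_of_isPivot (a := a) (fun x hx => hJ (Finset.erase_subset _ _ hx))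
    (by rw [Finset.card_erase_of_mem ha, hcard]; rfl), add_tsub_cancel_right,
    Finset.insert_erase ha]
  refine ⟨hJ ha, by simp, by simp, fun b hb hb' => ?_⟩
  rcases hb' with hb' | hb'
  · rcases Finset.mem_union.1 (Finsupp.support_add hb') with h | h
    · exact hmin b hb (Or.inl h)
    · rw [Finset.mem_singleton.1 (Finsupp.support_single_subset h)]
  · exact hmin b hb (Or.inr (Finset.mem_of_mem_erase hb'))

lemma sub_pivotProj_mem_range (y : EKMod k n t m (p + 2)) :
    y - pivotProj k m (p + 1) y ∈ LinearMap.range (matchMap k m p) := by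
  change y ∈ (LinearMap.range (matchMap k m p)).comap (LinearMap.id - pivotProj k m (p + 1))
  refine ekMod_induction (fun α i J hJ hcard => ?_) y
  rw [Submodule.mem_comap, LinearMap.sub_apply, LinearMap.id_apply]
  by_cases h : ∃ a, IsPivot k m α i J a
  · rw [pivotProj_of_isPivot h, sub_self]
    exact zero_mem _
  · obtain ⟨a, ha, hmin⟩ := exists_min_mem_of_not_isPivot hJ
      (Finset.card_pos.1 (by omega)) (not_exists.1 h)
    rw [pivotProj_of_not_isPivot h, sub_zero]
    exact ⟨_, matchMap_add_single hJ hcard ha hmin⟩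

lemma IsPivot.mem_insert_le (ha : IsPivot k m α i J a) {b : Fin n} (hb : b ∈ critSet k n t m i)
    (hb' : b ∈ (α - Finsupp.single a 1).support ∨ b ∈ insert a J) : a ≤ b := by
  rcases hb' with hb' | hb'
  · exact ha.2.2.2 b hb (Or.inl (Finsupp.support_mono tsub_le_self hb'))
  · rcases Finset.mem_insert.1 hb' with rfl | h
    · exact le_rfl
    · exact ha.2.2.2 b hb (Or.inr h)

lemma pivotProj_matchMap (y : EKMod k n t m (p + 1)) :
    pivotProj k m (p + 1) (matchMap k m p y) = 0 := by
  suffices h : pivotProj k m (p + 1) ∘ₗ matchMap k m p = 0 from LinearMap.congr_fun h y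
  refine ekMod_hom_ext fun α i J hJ hcard => ?_
  rw [LinearMap.comp_apply, LinearMap.zero_apply]
  by_cases h : ∃ a, IsPivot k m α i J a
  · obtain ⟨a, ha⟩ := h
    rw [matchMap_of_isPivot hJ hcard ha, pivotProj_of_not_isPivot]
    rintro ⟨b, hb⟩
    exact not_isPivot_of_mem (Finset.mem_insert_self a J) ha.1
      (fun b hb hb' => ha.mem_insert_le hb hb') b hb
  · rw [matchMap_of_not_isPivot hJ hcard h, map_zero]

lemma range_matchMap (p : ℕ) :
    LinearMap.range (matchMap k m p) = Submodule.span k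
      { y : EKMod k n t m (p + 2) | ∃ (α : Fin n →₀ ℕ) (q : EKIndex k n t m (p + 1)),
        (∃ a ∈ q.1.2, ∀ b : Fin n,
          (b ∈ α.support ∨ b ∈ q.1.2) → b ∈ critSet k n t m q.1.1 → a ≤ b)
        ∧ y = Finsupp.single q (monomial α (1 : k)) } := by
  refine le_antisymm ?_ (Submodule.span_le.2 ?_)
  · rintro _ ⟨y, rfl⟩
    rw [← Submodule.mem_comap]
    refine ekMod_induction (fun α i J hJ hcard => ?_) y
    rw [Submodule.mem_comap]
    by_cases h : ∃ a, IsPivot k m α i J a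
    · obtain ⟨a, ha⟩ := h
      rw [matchMap_of_isPivot hJ hcard ha]
      have hins : (↑(insert a J) : Set (Fin n)) ⊆ critSet k n t m i := by
        rw [Finset.coe_insert]
        exact Set.insert_subset ha.1 hJ
      have hcard' : (insert a J).card = p + 1 := by
        rw [Finset.card_insert_of_notMem ha.2.2.1, hcard]
      exact Submodule.subset_span ⟨α - Finsupp.single a 1,
        (⟨(i, insert a J), hins, hcard'⟩ : EKIndex k n t m (p + 1)),
        ⟨a, Finset.mem_insert_self a J, fun b hb hb' => ha.mem_insert_le hb' hb⟩,
        ekMon_eq_single ⟨hins, hcard'⟩⟩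
    · rw [matchMap_of_not_isPivot hJ hcard h]
      exact zero_mem _
  · rintro _ ⟨α, q, ⟨a, ha, hmin⟩, rfl⟩
    rw [single_eq_ekMon]
    exact ⟨_, matchMap_add_single q.2.1 q.2.2 ha fun b hb hb' => hmin b hb' hb⟩

end Matching

section Homotopy

variable {k : Type} [Field k] {n t : ℕ} {m : Fin t → (Fin n →₀ ℕ)}
  {κ : Fin t → Fin n → Fin t} {u : Fin t → Fin n → (Fin n →₀ ℕ)}
  {d : ∀ p : ℕ, EKMod k n t m (p + 1) →ₗ[k] EKMod k n t m p} {p : ℕ}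

/-- The span of the basis elements of `G̃_{p+1}` on the first `s` generators. -/
noncomputable def ekFiltration (k : Type) [Field k] {n t : ℕ} (m : Fin t → (Fin n →₀ ℕ)) (p s : ℕ) :
    Submodule k (EKMod k n t m (p + 1)) :=
  Submodule.span k {y | ∃ (α : Fin n →₀ ℕ) (i : Fin t) (J : Finset (Fin n)),
    (i : ℕ) < s ∧ y = ekMon k m p α i J}

lemma ekMon_mem_ekFiltration {α : Fin n →₀ ℕ} {i : Fin t} {J : Finset (Fin n)} {s : ℕ}
    (hi : (i : ℕ) < s) : ekMon k m p α i J ∈ ekFiltration k m p s :=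
  Submodule.subset_span ⟨α, i, J, hi, rfl⟩

lemma pivotProj_ekMon_mem_ekFiltration {α : Fin n →₀ ℕ} {i : Fin t} {J : Finset (Fin n)} {s : ℕ}
    (hi : (i : ℕ) < s) : pivotProj k m p (ekMon k m p α i J) ∈ ekFiltration k m p s := by
  by_cases h : ∃ a, IsPivot k m α i J a
  · rw [pivotProj_of_isPivot h]
    exact ekMon_mem_ekFiltration hi
  · rw [pivotProj_of_not_isPivot h]
    exact zero_mem _

lemma isNilpotent_of_ekFiltration (ν : Module.End k (EKMod k n t m (p + 1)))
    (h : ∀ (α : Fin n →₀ ℕ) (i : Fin t) (J : Finset (Fin n)),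
      ν (ekMon k m p α i J) ∈ ekFiltration k m p i) : IsNilpotent ν := by
  have hpow : ∀ s : ℕ, ekFiltration k m p s ≤ LinearMap.ker (ν ^ s) := by
    intro s
    induction s with
    | zero =>
      refine Submodule.span_le.2 ?_
      rintro _ ⟨α, i, J, hi, _⟩
      exact absurd hi (Nat.not_lt_zero _)
    | succ s ih =>
      refine Submodule.span_le.2 ?_
      rintro _ ⟨α, i, J, hi, rfl⟩
      have hle : ekFiltration k m p (i : ℕ) ≤ ekFiltration k m p s := by
        refine Submodule.span_mono ?_
        rintro _ ⟨α', i', J', hi', rfl⟩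
        exact ⟨α', i', J', by omega, rfl⟩
      have := ih (hle (h α i J))
      rw [LinearMap.mem_ker] at this
      rw [SetLike.mem_coe, LinearMap.mem_ker, pow_succ, Module.End.mul_apply, this]
  refine ⟨t, LinearMap.ext fun y => ?_⟩
  exact ekMod_induction (Q := LinearMap.ker (ν ^ t))
    (fun α i J _ _ => hpow t (ekMon_mem_ekFiltration i.2)) y

lemma IsEKDifferential.d_matchMapZero (hd : IsEKDifferential κ u d) (y : EKMod k n t m 0) :
    d 0 (matchMapZero k m y) = pivotProjZero k m y := by
  suffices h : d 0 ∘ₗ matchMapZero k m = pivotProjZero k m from LinearMap.congr_fun h y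
  refine ekModZero_hom_ext fun α => ?_
  rw [LinearMap.comp_apply]
  by_cases h : ∃ i, m i ≤ α
  · obtain ⟨i, hi, hmin⟩ := exists_isLeast h
    rw [matchMapZero_of_isLeast hi hmin, hd.zero, pivotProjZero_of_le h, tsub_add_cancel_of_le hi]
  · rw [matchMapZero_of_not_le h, map_zero, pivotProjZero_of_not_le h]

namespace IsCritMonotone

lemma sub_pivotProj_mem_range_zero (H : IsCritMonotone k n t m κ u)
    (y : EKMod k n t m 1) :
    y - pivotProj k m 0 y ∈ LinearMap.range (matchMapZero k m) := by
  change y ∈ (LinearMap.range (matchMapZero k m)).comap (LinearMap.id - pivotProj k m 0)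
  refine ekMod_induction (fun α i J hJ hcard => ?_) y
  rw [Submodule.mem_comap, LinearMap.sub_apply, LinearMap.id_apply]
  by_cases h : ∃ a, IsPivot k m α i J a
  · rw [pivotProj_of_isPivot h, sub_self]
    exact zero_mem _
  · obtain rfl := Finset.card_eq_zero.1 hcard
    have hdisj : ∀ g ∈ α.support, g ∉ critSet k n t m i := by
      intro g hg hgA
      have hne : (Finset.univ.filter fun b => b ∈ critSet k n t m i ∧ b ∈ α.support).Nonempty :=
        ⟨g, by rw [Finset.mem_filter]; exact ⟨Finset.mem_univ _, hgA, hg⟩⟩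
      have hmem := (Finset.mem_filter.1 (Finset.min'_mem _ hne)).2
      refine h ⟨Finset.min' _ hne, hmem.1, hmem.2, Finset.notMem_empty _, fun b hb hb' => ?_⟩
      refine Finset.min'_le _ _ (Finset.mem_filter.2 ⟨Finset.mem_univ _, hb, ?_⟩)
      exact hb'.resolve_right (Finset.notMem_empty _)
    rw [pivotProj_of_not_isPivot h, sub_zero]
    refine ⟨ekMonZero k m (α + m i), ?_⟩
    rw [matchMapZero_of_isLeast (i := i) le_add_self, add_tsub_cancel_right]
    intro i' hi'
    by_contra! hlt
    obtain ⟨a, ha, ha'⟩ := H.exists_mem hlt hi'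
    exact hdisj a ha' ha

lemma pivotProj_d_matchMap_mem (H : IsCritMonotone k n t m κ u) (hd : IsEKDifferential κ u d)
    {α : Fin n →₀ ℕ} {i : Fin t} {J : Finset (Fin n)} {a : Fin n}
    (hJ : ↑J ⊆ critSet k n t m i) (hcard : J.card = p) (ha : IsPivot k m α i J a) :
    ekMon k m p α i J - pivotProj k m p (d (p + 1) (matchMap k m p (ekMon k m p α i J))) ∈
      ekFiltration k m p i := by
  have hins : ((insert a J : Finset (Fin n)) : Set (Fin n)) ⊆ critSet k n t m i := by
    rw [Finset.coe_insert]
    exact Set.insert_subset ha.1 hJ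
  have hlt : ∀ j ∈ insert a J, ((κ i j : Fin t) : ℕ) < i := fun j hj => H.lt (hins hj)
  have hempty : (insert a J).filter (· < a) = ∅ := by
    refine Finset.filter_eq_empty_iff.2 fun b hb => not_lt.2 ?_
    exact ha.mem_insert_le (hins hb) (Or.inr hb)
  have hle : Finsupp.single a 1 ≤ α := by
    rw [Finsupp.single_le_iff, Nat.one_le_iff_ne_zero]
    exact Finsupp.mem_support_iff.1 ha.2.1
  rw [matchMap_of_isPivot hJ hcard ha, hd.succ p _ i _ hins
    (by rw [Finset.card_insert_of_notMem ha.2.2.1, hcard]), Finset.sum_insert ha.2.2.1,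
    hempty, Finset.card_empty, pow_zero, one_smul, Finset.erase_insert ha.2.2.1,
    tsub_add_cancel_of_le hle, map_add, map_sub, pivotProj_of_isPivot ⟨a, ha⟩, map_sum,
    sub_add_eq_sub_sub, sub_sub_cancel]
  refine sub_mem (pivotProj_ekMon_mem_ekFiltration (hlt a (Finset.mem_insert_self a J)))
    (sum_mem fun j hj => ?_)
  have hja : j ≠ a := fun h => ha.2.2.1 (h ▸ hj)
  rw [map_zsmul, map_sub, pivotProj_of_not_isPivot, zero_sub]
  · exact zsmul_mem (neg_mem
      (pivotProj_ekMon_mem_ekFiltration (hlt j (Finset.mem_insert_of_mem hj)))) _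
  · rintro ⟨b, hb⟩
    refine not_isPivot_of_mem (a := a)
      (Finset.mem_erase.2 ⟨hja.symm, Finset.mem_insert_self a J⟩) ha.1 (fun b hb hb' => ?_) b hb
    rcases hb' with hb' | hb'
    · rcases Finset.mem_union.1 (Finsupp.support_add hb') with h | h
      · exact ha.mem_insert_le hb (Or.inl h)
      · rw [Finset.mem_singleton.1 (Finsupp.support_single_subset h)]
        exact ha.2.2.2 j (hJ hj) (Or.inr hj)
    · exact ha.mem_insert_le hb (Or.inr (Finset.mem_of_mem_erase hb'))

lemma isNilpotent_error (H : IsCritMonotone k n t m κ u) (hd : IsEKDifferential κ u d)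
    (p : ℕ) :
    IsNilpotent (pivotProj k m p - pivotProj k m p ∘ₗ d (p + 1) ∘ₗ matchMap k m p :
      Module.End k (EKMod k n t m (p + 1))) := by
  refine isNilpotent_of_ekFiltration _ fun α i J => ?_
  rw [LinearMap.sub_apply, LinearMap.comp_apply, LinearMap.comp_apply]
  by_cases hv : ↑J ⊆ critSet k n t m i ∧ J.card = p
  · by_cases h : ∃ a, IsPivot k m α i J a
    · obtain ⟨a, ha⟩ := h
      rw [pivotProj_of_isPivot ⟨a, ha⟩]
      exact H.pivotProj_d_matchMap_mem hd hv.1 hv.2 ha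
    · rw [matchMap_of_not_isPivot hv.1 hv.2 h, pivotProj_of_not_isPivot h, map_zero, map_zero,
        sub_zero]
      exact zero_mem _
  · simp only [ekMon_eq_zero hv, map_zero, sub_zero]
    exact zero_mem _

/-- The contracting homotopy. -/
theorem exists_homotopy (H : IsCritMonotone k n t m κ u) (hd : IsEKDifferential κ u d) :
    ∃ c : ∀ p : ℕ, EKMod k n t m p →ₗ[k] EKMod k n t m (p + 1),
      c 0 = matchMapZero k m ∧
      (∀ (p : ℕ) (y : EKMod k n t m (p + 1)), d (p + 1) (c (p + 1) y) + c p (d p y) = y) ∧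
      (∀ (p : ℕ) (y : EKMod k n t m p), c (p + 1) (c p y) = 0) ∧
      ∀ p, LinearMap.range (c (p + 1)) = LinearMap.range (matchMap k m p) := by
  choose c hcP hPDc hcPD hrange using fun p => exists_perturbed_inverse (d (p + 1))
    (matchMap k m p) (pivotProj k m p) pivotProj_pivotProj matchMap_pivotProj
    (H.isNilpotent_error hd p)
  refine ⟨fun p => match p with
    | 0 => matchMapZero k m
    | p + 1 => c p, rfl, fun p y => ?_, fun p y => ?_, hrange⟩
  · cases p with
    | zero =>
      refine homotopy_identity (d 0) (d 1) (H.d_comp_d hd) (matchMapZero k m) (pivotProjZero k m)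
        (pivotProj k m 0) (matchMapZero k m) (c 0) H.sub_pivotProj_mem_range_zero
        matchMapZero_pivotProjZero (fun x => ?_) (hPDc 0) y
      rw [hd.d_matchMapZero, matchMapZero_pivotProjZero, matchMapZero_pivotProjZero]
    | succ p =>
      exact homotopy_identity (d (p + 1)) (d (p + 2)) (H.d_comp_d hd) (matchMap k m p)
        (pivotProj k m p) (pivotProj k m (p + 1)) (c p) (c (p + 1)) sub_pivotProj_mem_range
        (hcP p) (hcPD p) (hPDc (p + 1)) y
  · cases p with
    | zero =>
      change c 0 (matchMapZero k m y) = 0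
      rw [← hcP]
      suffices h : pivotProj k m 0 ∘ₗ matchMapZero k m = 0 by
        rw [← LinearMap.comp_apply (pivotProj k m 0), h, LinearMap.zero_apply, map_zero]
      refine ekModZero_hom_ext fun α => ?_
      rw [LinearMap.comp_apply, LinearMap.zero_apply]
      by_cases h : ∃ i, m i ≤ α
      · obtain ⟨i, hi, hmin⟩ := exists_isLeast h
        rw [matchMapZero_of_isLeast hi hmin, pivotProj_of_not_isPivot]
        rintro ⟨a, haA, haα, -⟩
        obtain ⟨i', hi', hle⟩ := mem_critSet_iff.1 haA
        refine (hmin i' (hle.trans ?_)).not_gt hi'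
        refine (add_le_add_left ?_ (m i)).trans (tsub_add_cancel_of_le hi).le
        rw [Finsupp.single_le_iff, Nat.one_le_iff_ne_zero]
        exact Finsupp.mem_support_iff.1 haα
      · rw [matchMapZero_of_not_le h, map_zero]
    | succ p =>
      change c (p + 1) (c p y) = 0
      have hy : c p y ∈ LinearMap.range (c p) := ⟨y, rfl⟩
      rw [hrange] at hy
      obtain ⟨x, hx⟩ := hy
      rw [← hcP, ← hx, pivotProj_matchMap, map_zero]

end IsCritMonotone

end Homotopy

/-- Let `I ⊆ S = k[x_1,…,x_n]` be a crit-monotone monomial ideal with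
linear quotients with respect to `m_1, …, m_t`, with critical-index sets `A_i`, and let
`G̃` be the associated Eliahou–Kervaire-type complex.  Then there exist `k`-linear maps
`c_p : G̃_p → G̃_{p+1}` such that:
(i) for every monomial `w ∈ I`, `c_0(w) = (w/m_i)·e_∅ g_i` where `i` is the least index
with `m_i ∣ w`, and `c_0(w) = 0` for monomials `w ∉ I`;
(ii) `d ∘ c + c ∘ d = id` in degrees `≥ 1`, and `d_1 ∘ c_0 = id − η` on `G̃_0 = S`, where
`η` is the `k`-linear projection fixing monomials not in `I` and killing monomials in `I`;
(iii) `c ∘ c = 0`;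
(iv) for `p ≥ 1` the image of `c_p` is spanned over `k` by the elements `x^α·e_J g_i`
with `min((supp x^α ∪ J) ∩ A_i) ∈ J`. -/
theorem stmt_12 (k : Type) [Field k] (n t : ℕ)
    (m : Fin t → (Fin n →₀ ℕ))
    (hproper : ∀ i, m i ≠ 0)
    (hmin : ∀ i j : Fin t, i ≠ j → ¬ m i ≤ m j)
    (hLQ : ∀ i : Fin t, ∃ V : Set (Fin n),
      colonIdeal k n t m i = Ideal.span ((fun g => (X g : MvPolynomial (Fin n) k)) '' V))
    (κ : Fin t → Fin n → Fin t) (u : Fin t → Fin n → (Fin n →₀ ℕ))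
    (hκu : ∀ i : Fin t, ∀ j ∈ critSet k n t m i,
      Finsupp.single j 1 + m i = u i j + m (κ i j) ∧
      ∀ g ∈ (u i j).support, g ∉ critSet k n t m (κ i j))
    (hcm : ∀ i : Fin t, ∀ j ∈ critSet k n t m i,
      critSet k n t m (κ i j) ⊆ critSet k n t m i)
    (d : ∀ p : ℕ, EKMod k n t m (p + 1) →ₗ[MvPolynomial (Fin n) k] EKMod k n t m p)
    (hd0 : ∀ q : EKIndex k n t m 0,
      d 0 (Finsupp.single q 1) = monomial (m q.1.1) (1 : k))
    (hd : ∀ (p : ℕ) (i : Fin t) (J : Finset (Fin n)) (h1 : ↑J ⊆ critSet k n t m i)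
        (h2 : J.card = p + 1),
      d (p + 1) (ekGen k n t m i J h1 h2) =
        ∑ j ∈ J.attach, (-1 : ℤ) ^ (J.filter (· < ↑j)).card •
          ((X (↑j : Fin n) : MvPolynomial (Fin n) k) •
              ekGen k n t m (p := p) i (J.erase ↑j)
                (fun x hx => h1 (Finset.erase_subset _ _ hx))
                (by simp [Finset.card_erase_of_mem j.2, h2])
            - if hc : ↑(J.erase (↑j : Fin n)) ⊆ critSet k n t m (κ i ↑j) then
                (monomial (u i ↑j) (1 : k)) •
                  ekGen k n t m (p := p) (κ i ↑j) (J.erase ↑j) hc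
                    (by simp [Finset.card_erase_of_mem j.2, h2])
              else 0))
    -- `η : S → S`, the `k`-linear projection fixing all monomials not in `I` and
    -- annihilating all monomials in `I`
    (η : MvPolynomial (Fin n) k →ₗ[k] MvPolynomial (Fin n) k)
    (hη : ∀ α : Fin n →₀ ℕ,
      η (monomial α (1 : k)) =
        if monomial α (1 : k) ∈ Ideal.span (Set.range fun i => monomial (m i) (1 : k))
        then 0 else monomial α (1 : k)) :
    ∃ c : ∀ p : ℕ, EKMod k n t m p →ₗ[k] EKMod k n t m (p + 1),
      -- (i)
      (∀ (α : Fin n →₀ ℕ) (i : Fin t), m i ≤ α → (∀ i', m i' ≤ α → i ≤ i') →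
        c 0 (monomial α (1 : k)) =
          (monomial (α - m i) (1 : k)) •
            ekGen k n t m (p := 0) i ∅ (by simp) rfl)
      ∧ (∀ α : Fin n →₀ ℕ,
          monomial α (1 : k) ∉ Ideal.span (Set.range fun i => monomial (m i) (1 : k)) →
          c 0 (monomial α (1 : k)) = 0)
      -- (ii)
      ∧ (∀ (p : ℕ) (y : EKMod k n t m (p + 1)),
          d (p + 1) (c (p + 1) y) + c p (d p y) = y)
      ∧ (∀ f : MvPolynomial (Fin n) k, d 0 (c 0 f) = f - η f)
      -- (iii)
      ∧ (∀ (p : ℕ) (y : EKMod k n t m p), c (p + 1) (c p y) = 0)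
      -- (iv)
      ∧ (∀ p : ℕ, LinearMap.range (c (p + 1)) =
          Submodule.span k
            { y : EKMod k n t m (p + 2) |
              ∃ (α : Fin n →₀ ℕ) (q : EKIndex k n t m (p + 1)),
                (∃ a ∈ q.1.2, ∀ b : Fin n,
                  (b ∈ α.support ∨ b ∈ q.1.2) → b ∈ critSet k n t m q.1.1 → a ≤ b)
                ∧ y = Finsupp.single q (monomial α (1 : k)) }) := by
  have H : IsCritMonotone k n t m κ u :=
    { exists_mem := exists_mem_critSet_of_le hLQ
      eq_add := fun {i j} hj => (hκu i j hj).1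
      notMem := fun {i j} hj => (hκu i j hj).2
      subset := fun {i j} hj => hcm i j hj }
  have hD : IsEKDifferential κ u fun p => (d p).restrictScalars k := by
    refine ⟨fun α i => ?_, fun p α i J h1 h2 => ?_⟩
    · have h : ↑(∅ : Finset (Fin n)) ⊆ critSet k n t m i ∧ (∅ : Finset (Fin n)).card = 0 :=
        ⟨by simp, rfl⟩
      change d 0 _ = _
      rw [← monomial_smul_ekGen h.1 h.2, map_smul]
      refine (congrArg (monomial α (1 : k) • ·) (hd0 ⟨(i, ∅), h⟩)).trans ?_
      exact monomial_mul.trans (by rw [mul_one]; rfl)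
    · change d (p + 1) _ = _
      rw [← monomial_smul_ekGen h1 h2, map_smul, hd, Finset.smul_sum, ← Finset.sum_attach J]
      refine Finset.sum_congr rfl fun j _ => ?_
      rw [smul_comm, smul_sub]
      refine congrArg _ (congrArg₂ (· - ·) ?_ ?_)
      · refine (congrArg _ (monomial_smul_ekGen _ _)).trans ?_
        exact monomial_smul_ekMon
      · by_cases hc : ↑(J.erase (j : Fin n)) ⊆ critSet k n t m (κ i j)
        · rw [dif_pos hc]
          refine (congrArg _ (monomial_smul_ekGen _ _)).trans ?_
          exact monomial_smul_ekMon
        · rw [dif_neg hc, smul_zero, ekMon_of_not_subset hc]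
  have hmem : ∀ α : Fin n →₀ ℕ, monomial α (1 : k) ∈
      Ideal.span (Set.range fun i => monomial (m i) (1 : k)) ↔ ∃ i, m i ≤ α := by
    intro α
    have h : (Set.range fun i => monomial (m i) (1 : k)) =
        (fun s => monomial s (1 : k)) '' Set.range m := by
      rw [← Set.range_comp]
      rfl
    rw [h, mem_ideal_span_monomial_image]
    simp [support_monomial]
  obtain ⟨c, hc0, hhom, hcc, hrange⟩ := H.exists_homotopy hD
  refine ⟨c, fun α i hi hmin => ?_, fun α hα => ?_, hhom, fun f => ?_, hcc, fun p => ?_⟩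
  · rw [hc0]
    exact (matchMapZero_of_isLeast hi hmin).trans (monomial_smul_ekGen _ _).symm
  · rw [hc0]
    exact matchMapZero_of_not_le fun h => hα ((hmem α).2 h)
  · have hη' : pivotProjZero k m = LinearMap.id - η := by
      refine ekModZero_hom_ext fun α => ?_
      by_cases h : ∃ i, m i ≤ α
      · rw [pivotProjZero_of_le h]
        exact (sub_eq_self.2 ((hη α).trans (if_pos ((hmem α).2 h)))).symm
      · rw [pivotProjZero_of_not_le h]
        exact (sub_eq_zero.2 ((hη α).trans (if_neg (mt (hmem α).1 h))).symm).symm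
    rw [hc0]
    exact (hD.d_matchMapZero f).trans (LinearMap.congr_fun hη' f)
  · rw [hrange, range_matchMap]
end
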